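/- arXiv:2206.06327 — 2 statements merged into one kernel-verified Lean document; each statement's English description precedes it below -/
import Mathlib

section
/- For every ν ∈ [0,1] and every φ ∈ C_c^∞(ℝ³, ℂ²), the following inhomogeneous Hardy-type inequality holds: ν ∫_{ℝ³} |φ(x)|²/|x| dx + √(1−ν²) ∫_{ℝ³} |φ(x)|² dx ≤ ∫_{ℝ³} |((σ·∇)φ)(x)|² / (ν/|x| + 1 + √(1−ν²)) dx + ∫_{ℝ³} |φ(x)|² dx. -/
open MeasureTheory Complex

noncomputable section

abbrev R3 := EuclideanSpace ℝ (Fin 3)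
abbrev C2 := EuclideanSpace ℂ (Fin 2)

/-- The `k`-th partial derivative of `φ : ℝ³ → ℂ²`. -/
noncomputable def pd (φ : R3 → C2) (k : Fin 3) (x : R3) : C2 :=
  fderiv ℝ φ x (EuclideanSpace.single k 1)

/-- `(σ·∇)φ = σ₁∂₁φ + σ₂∂₂φ + σ₃∂₃φ` with the Pauli matrices
`σ₁ = [[0,1],[1,0]]`, `σ₂ = [[0,-i],[i,0]]`, `σ₃ = [[1,0],[0,-1]]`. -/
noncomputable def sigmaGrad (φ : R3 → C2) (x : R3) : C2 :=
  (WithLp.equiv 2 (Fin 2 → ℂ)).symm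
    ![pd φ 0 x 1 - Complex.I * pd φ 1 x 1 + pd φ 2 x 0,
      pd φ 0 x 0 + Complex.I * pd φ 1 x 0 - pd φ 2 x 1]

/-- `φ ∈ C_c^∞(ℝ³, ℂ²)`. -/
def IsCc (φ : R3 → C2) : Prop := ContDiff ℝ (⊤ : ℕ∞) φ ∧ HasCompactSupport φ

/-- The `k`-th partial derivative of a real function on `ℝ³`. -/
def partialDeriv (k : Fin 3) (f : R3 → ℝ) (x : R3) : ℝ :=
  fderiv ℝ f x (EuclideanSpace.single k 1)

/-- The Jacobian determinant `∇h · (∇f × ∇g)` of three real functions on `ℝ³`. -/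
def jacobian (h f g : R3 → ℝ) (x : R3) : ℝ :=
  partialDeriv 0 h x * (partialDeriv 1 f x * partialDeriv 2 g x
      - partialDeriv 2 f x * partialDeriv 1 g x)
    + partialDeriv 1 h x * (partialDeriv 2 f x * partialDeriv 0 g x
      - partialDeriv 0 f x * partialDeriv 2 g x)
    + partialDeriv 2 h x * (partialDeriv 0 f x * partialDeriv 1 g x
      - partialDeriv 1 f x * partialDeriv 0 g x)

lemma contDiff_partialDeriv {f : R3 → ℝ} (hf : ContDiff ℝ (⊤ : ℕ∞) f) (k : Fin 3) :
    ContDiff ℝ (⊤ : ℕ∞) (partialDeriv k f) :=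
  (hf.fderiv_right (m := ((⊤ : ℕ∞) : WithTop ℕ∞)) (by simp)).clm_apply contDiff_const

lemma partialDeriv_mul {f g : R3 → ℝ} {x : R3} (k : Fin 3) (hf : DifferentiableAt ℝ f x)
    (hg : DifferentiableAt ℝ g x) :
    partialDeriv k (fun y => f y * g y) x
      = partialDeriv k f x * g x + f x * partialDeriv k g x := by
  simp only [partialDeriv, fderiv_fun_mul hf hg]
  simp
  ring

lemma partialDeriv_sub {f g : R3 → ℝ} {x : R3} (k : Fin 3) (hf : DifferentiableAt ℝ f x)
    (hg : DifferentiableAt ℝ g x) :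
    partialDeriv k (fun y => f y - g y) x = partialDeriv k f x - partialDeriv k g x := by
  simp [partialDeriv, fderiv_fun_sub hf hg]

lemma partialDeriv_comm {f : R3 → ℝ} (hf : ContDiff ℝ (⊤ : ℕ∞) f) (j k : Fin 3) (x : R3) :
    partialDeriv j (partialDeriv k f) x = partialDeriv k (partialDeriv j f) x := by
  have hd : DifferentiableAt ℝ (fderiv ℝ f) x :=
    (hf.fderiv_right (m := ((⊤ : ℕ∞) : WithTop ℕ∞)) (by simp)).differentiable (by simp) x
  have key : ∀ i l : Fin 3, partialDeriv i (partialDeriv l f) x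
      = fderiv ℝ (fderiv ℝ f) x (EuclideanSpace.single i 1) (EuclideanSpace.single l 1) := by
    intro i l
    have : partialDeriv l f = fun y => fderiv ℝ f y (EuclideanSpace.single l 1) := rfl
    rw [this, partialDeriv, fderiv_clm_apply hd (differentiableAt_const _)]
    simp
  rw [key, key]
  exact (hf.contDiffAt.isSymmSndFDerivAt (by
    simpa using WithTop.coe_le_coe.2 (le_top : (2 : ℕ∞) ≤ ⊤))) _ _

lemma integrable_partialDeriv {f : R3 → ℝ} (hf : ContDiff ℝ (⊤ : ℕ∞) f)
    (hc : HasCompactSupport f) (k : Fin 3) : Integrable (partialDeriv k f) :=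
  (contDiff_partialDeriv hf k).continuous.integrable_of_hasCompactSupport (hc.fderiv_apply ℝ _)

lemma integral_partialDeriv {f : R3 → ℝ} (hf : ContDiff ℝ (⊤ : ℕ∞) f)
    (hc : HasCompactSupport f) (k : Fin 3) : ∫ x, partialDeriv k f x = 0 := by
  have h := integral_mul_fderiv_eq_neg_fderiv_mul_of_integrable (μ := (volume : Measure R3))
    (f := fun _ => (1 : ℝ)) (g := f) (v := EuclideanSpace.single k 1) (by simp)
    (by simp only [one_mul]; exact integrable_partialDeriv hf hc k)
    (by simpa using hf.continuous.integrable_of_hasCompactSupport hc)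
    (fun x _ => differentiableAt_const _) (fun x _ => hf.differentiable (by simp) x)
  simpa [partialDeriv] using h

lemma jacobian_eq_divergence {h f g : R3 → ℝ} (hh : ContDiff ℝ (⊤ : ℕ∞) h)
    (hf : ContDiff ℝ (⊤ : ℕ∞) f) (hg : ContDiff ℝ (⊤ : ℕ∞) g) (x : R3) :
    jacobian h f g x =
      partialDeriv 0 (fun y => f y * (partialDeriv 1 g y * partialDeriv 2 h y
          - partialDeriv 2 g y * partialDeriv 1 h y)) x
        + partialDeriv 1 (fun y => f y * (partialDeriv 2 g y * partialDeriv 0 h y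
          - partialDeriv 0 g y * partialDeriv 2 h y)) x
        + partialDeriv 2 (fun y => f y * (partialDeriv 0 g y * partialDeriv 1 h y
          - partialDeriv 1 g y * partialDeriv 0 h y)) x := by
  have df : DifferentiableAt ℝ f x := hf.differentiable (by simp) x
  have dg : ∀ k, DifferentiableAt ℝ (partialDeriv k g) x := fun k =>
    (contDiff_partialDeriv hg k).differentiable (by simp) x
  have dh : ∀ k, DifferentiableAt ℝ (partialDeriv k h) x := fun k =>
    (contDiff_partialDeriv hh k).differentiable (by simp) x
  have key : ∀ i j k : Fin 3,
      partialDeriv i (fun y => f y * (partialDeriv j g y * partialDeriv k h y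
          - partialDeriv k g y * partialDeriv j h y)) x
        = partialDeriv i f x * (partialDeriv j g x * partialDeriv k h x
            - partialDeriv k g x * partialDeriv j h x)
          + f x * ((partialDeriv i (partialDeriv j g) x * partialDeriv k h x
              + partialDeriv j g x * partialDeriv i (partialDeriv k h) x)
            - (partialDeriv i (partialDeriv k g) x * partialDeriv j h x
              + partialDeriv k g x * partialDeriv i (partialDeriv j h) x)) := by
    intro i j k
    rw [partialDeriv_mul i df (((dg j).fun_mul (dh k)).fun_sub ((dg k).fun_mul (dh j))),
      partialDeriv_sub i ((dg j).fun_mul (dh k)) ((dg k).fun_mul (dh j)),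
      partialDeriv_mul i (dg j) (dh k), partialDeriv_mul i (dg k) (dh j)]
  rw [key, key, key, jacobian, partialDeriv_comm hg 1 0, partialDeriv_comm hg 2 0,
    partialDeriv_comm hg 2 1, partialDeriv_comm hh 1 0, partialDeriv_comm hh 2 0,
    partialDeriv_comm hh 2 1]
  ring

lemma integrable_and_integral_jacobian {h f g : R3 → ℝ} (hh : ContDiff ℝ (⊤ : ℕ∞) h)
    (hf : ContDiff ℝ (⊤ : ℕ∞) f) (hg : ContDiff ℝ (⊤ : ℕ∞) g) (hc : HasCompactSupport f) :
    Integrable (jacobian h f g) ∧ ∫ x, jacobian h f g x = 0 := by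
  have hs : ∀ j k : Fin 3, ContDiff ℝ (⊤ : ℕ∞) (fun y => f y * (partialDeriv j g y *
      partialDeriv k h y - partialDeriv k g y * partialDeriv j h y)) := fun j k =>
    hf.mul (((contDiff_partialDeriv hg j).mul (contDiff_partialDeriv hh k)).sub
      ((contDiff_partialDeriv hg k).mul (contDiff_partialDeriv hh j)))
  have hsc : ∀ j k : Fin 3, HasCompactSupport (fun y => f y * (partialDeriv j g y *
      partialDeriv k h y - partialDeriv k g y * partialDeriv j h y)) := fun j k => hc.mul_right
  have hi : ∀ i j k : Fin 3, Integrable (partialDeriv i (fun y => f y * (partialDeriv j g y *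
      partialDeriv k h y - partialDeriv k g y * partialDeriv j h y))) := fun i j k =>
    integrable_partialDeriv (hs j k) (hsc j k) i
  simp only [funext (jacobian_eq_divergence hh hf hg)]
  refine ⟨((hi 0 1 2).add (hi 1 2 0)).add (hi 2 0 1), ?_⟩
  rw [integral_add (f := fun x => _ + _) ((hi 0 1 2).add (hi 1 2 0)) (hi 2 0 1),
    integral_add (hi 0 1 2) (hi 1 2 0),
    integral_partialDeriv (hs 1 2) (hsc 1 2), integral_partialDeriv (hs 2 0) (hsc 2 0),
    integral_partialDeriv (hs 0 1) (hsc 0 1)]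
  simp

set_option maxRecDepth 10000 in
/-- For a spinor gradient with real components `∇p, ∇q, ∇u, ∇v`, the part of the gradient
orthogonal to `(x, y, z)` dominates the corresponding quadratic null form. -/
lemma null_form_le_tangential (x y z p1 p2 p3 q1 q2 q3 u1 u2 u3 v1 v2 v3 : ℝ) :
    2 * (z * (x * (u2 * v3 - u3 * v2) + y * (u3 * v1 - u1 * v3) + z * (u1 * v2 - u2 * v1))
        - z * (x * (p2 * q3 - p3 * q2) + y * (p3 * q1 - p1 * q3) + z * (p1 * q2 - p2 * q1))
        + y * (x * (p2 * u3 - p3 * u2) + y * (p3 * u1 - p1 * u3) + z * (p1 * u2 - p2 * u1))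
        + y * (x * (q2 * v3 - q3 * v2) + y * (q3 * v1 - q1 * v3) + z * (q1 * v2 - q2 * v1))
        - x * (x * (p2 * v3 - p3 * v2) + y * (p3 * v1 - p1 * v3) + z * (p1 * v2 - p2 * v1))
        + x * (x * (q2 * u3 - q3 * u2) + y * (q3 * u1 - q1 * u3) + z * (q1 * u2 - q2 * u1)))
      ≤ (x ^ 2 + y ^ 2 + z ^ 2) * (p1 ^ 2 + p2 ^ 2 + p3 ^ 2 + q1 ^ 2 + q2 ^ 2 + q3 ^ 2
          + u1 ^ 2 + u2 ^ 2 + u3 ^ 2 + v1 ^ 2 + v2 ^ 2 + v3 ^ 2)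
        - ((x * p1 + y * p2 + z * p3) ^ 2 + (x * q1 + y * q2 + z * q3) ^ 2
          + (x * u1 + y * u2 + z * u3) ^ 2 + (x * v1 + y * v2 + z * v3) ^ 2) := by
  rcases (by positivity : 0 ≤ x ^ 2 + y ^ 2 + z ^ 2).eq_or_lt with h0 | hpos
  · have hx : x = 0 := by nlinarith [sq_nonneg x, sq_nonneg y, sq_nonneg z]
    have hy : y = 0 := by nlinarith [sq_nonneg x, sq_nonneg y, sq_nonneg z]
    have hz : z = 0 := by nlinarith [sq_nonneg x, sq_nonneg y, sq_nonneg z]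
    simp [hx, hy, hz]
  · rw [← sub_nonneg]
    refine nonneg_of_mul_nonneg_right (a := x ^ 2 + y ^ 2 + z ^ 2) ?_ hpos
    have hsq : 0 ≤ (1 / 2 : ℝ) * (
        (z*(y*p3-z*p2)+x*(y*u3-z*u2)+y*(y*v3-z*v2) - (x*(x*q1+y*q2+z*q3) - (x^2+y^2+z^2)*q1))^2
      + (z*(y*q3-z*q2)+x*(y*v3-z*v2)-y*(y*u3-z*u2) + (x*(x*p1+y*p2+z*p3) - (x^2+y^2+z^2)*p1))^2
      + (x*(y*p3-z*p2)-y*(y*q3-z*q2)-z*(y*u3-z*u2) - (x*(x*v1+y*v2+z*v3) - (x^2+y^2+z^2)*v1))^2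
      + (x*(y*q3-z*q2)+y*(y*p3-z*p2)-z*(y*v3-z*v2) + (x*(x*u1+y*u2+z*u3) - (x^2+y^2+z^2)*u1))^2
      + (z*(z*p1-x*p3)+x*(z*u1-x*u3)+y*(z*v1-x*v3) - (y*(x*q1+y*q2+z*q3) - (x^2+y^2+z^2)*q2))^2
      + (z*(z*q1-x*q3)+x*(z*v1-x*v3)-y*(z*u1-x*u3) + (y*(x*p1+y*p2+z*p3) - (x^2+y^2+z^2)*p2))^2
      + (x*(z*p1-x*p3)-y*(z*q1-x*q3)-z*(z*u1-x*u3) - (y*(x*v1+y*v2+z*v3) - (x^2+y^2+z^2)*v2))^2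
      + (x*(z*q1-x*q3)+y*(z*p1-x*p3)-z*(z*v1-x*v3) + (y*(x*u1+y*u2+z*u3) - (x^2+y^2+z^2)*u2))^2
      + (z*(x*p2-y*p1)+x*(x*u2-y*u1)+y*(x*v2-y*v1) - (z*(x*q1+y*q2+z*q3) - (x^2+y^2+z^2)*q3))^2
      + (z*(x*q2-y*q1)+x*(x*v2-y*v1)-y*(x*u2-y*u1) + (z*(x*p1+y*p2+z*p3) - (x^2+y^2+z^2)*p3))^2
      + (x*(x*p2-y*p1)-y*(x*q2-y*q1)-z*(x*u2-y*u1) - (z*(x*v1+y*v2+z*v3) - (x^2+y^2+z^2)*v3))^2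
      + (x*(x*q2-y*q1)+y*(x*p2-y*p1)-z*(x*v2-y*v1)
          + (z*(x*u1+y*u2+z*u3) - (x^2+y^2+z^2)*u3))^2) := by positivity
    refine hsq.trans_eq ?_
    ring

/-- The radial completion of the square. -/
lemma radial_square_bound {r ρ ν s c m a w N Y P G T : ℝ} (hρ : 0 < ρ) (hr : r ≤ ρ ^ 2)
    (hν : 0 ≤ ν) (hs : 0 ≤ s) (hm : m = ν / ρ + 1 + s) (ha : a = 1 / m)
    (hw : w = ν / (ρ ^ 3 * m ^ 2)) (hc : c * (1 + s) = ν) (hνs : ν ^ 2 = 1 - s ^ 2)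
    (hN : 0 ≤ N) (hG : 0 ≤ G) (hP : P ≤ r * G) (hT : T ≤ r * G - P)
    (hY : 0 ≤ P + 2 * (c * ρ * m) * Y + (c * ρ * m) ^ 2 * N) :
    ν / ρ * N + s * N
      ≤ a * G - w * T + N + c * ((3 / ρ - r / ρ ^ 3) * N + 2 / ρ * Y) := by
  have hm0 : 0 < m := by rw [hm]; positivity
  have hc0 : 0 ≤ c := nonneg_of_mul_nonneg_left (hc.symm ▸ hν) (by positivity)
  have hw0 : 0 ≤ w := by rw [hw]; positivity
  have hα : 0 ≤ a / ρ ^ 2 - w := by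
    have : a / ρ ^ 2 - w = (1 + s) / (ρ ^ 2 * m ^ 2) := by
      have h : m * ρ = ν + (1 + s) * ρ := by rw [hm]; field_simp; ring
      rw [ha, hw]
      field_simp
      linear_combination h
    rw [this]
    positivity
  have ha0 : 0 ≤ a := by rw [ha]; positivity
  have h1 : a / ρ ^ 2 * P ≤ a * G - w * T := by
    have e1 : a * G = a / ρ ^ 2 * (ρ ^ 2 * G) := by field_simp
    have e2 : a / ρ ^ 2 * (r * G) ≤ a / ρ ^ 2 * (ρ ^ 2 * G) := by gcongr
    have e3 := mul_le_mul_of_nonneg_left hP hα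
    have e4 := mul_le_mul_of_nonneg_left hT hw0
    linarith
  have h2 : 0 ≤ a / ρ ^ 2 * (P + 2 * (c * ρ * m) * Y + (c * ρ * m) ^ 2 * N) := by positivity
  have h3 : a / ρ ^ 2 * (P + 2 * (c * ρ * m) * Y + (c * ρ * m) ^ 2 * N)
      = a / ρ ^ 2 * P + c * (2 / ρ * Y) + c ^ 2 * m * N := by
    rw [ha]; field_simp
  have h4 : c ^ 2 * m = c ^ 2 * ν / ρ + (1 - s) := by
    have h5 : c ^ 2 * (1 + s) = 1 - s := by
      refine mul_right_cancel₀ (b := 1 + s) (by positivity) ?_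
      linear_combination (c * (1 + s) + ν) * hc + hνs
    rw [hm]; linear_combination h5
  have h6 : c ^ 2 * ν = 2 * c - ν := by
    refine mul_right_cancel₀ (b := (1 + s) ^ 2) (by positivity) ?_
    linear_combination (ν * (c * (1 + s) + ν) - 2 * (1 + s)) * hc + ν * hνs
  have h7 : c * (2 / ρ * N) ≤ c * ((3 / ρ - r / ρ ^ 3) * N) := by
    have : r / ρ ^ 3 ≤ 1 / ρ := by
      rw [div_le_div_iff₀ (by positivity) hρ]
      nlinarith
    have e : 2 / ρ ≤ 3 / ρ - r / ρ ^ 3 := by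
      have : (3 : ℝ) / ρ = 2 / ρ + 1 / ρ := by ring
      linarith
    gcongr
  have h8 : c ^ 2 * m * N = c * (2 / ρ * N) - ν / ρ * N + (1 - s) * N := by
    rw [h4, h6]; ring
  linarith

lemma partialDeriv_coord (k l : Fin 3) (x : R3) :
    partialDeriv k (fun y => y l) x = if l = k then 1 else 0 := by
  have : fderiv ℝ (fun y : R3 => y l) x = EuclideanSpace.proj l :=
    (EuclideanSpace.proj (𝕜 := ℝ) l).hasFDerivAt.fderiv
  rw [partialDeriv, this]
  simp

lemma contDiff_coord (l : Fin 3) : ContDiff ℝ (⊤ : ℕ∞) (fun y : R3 => y l) :=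
  (EuclideanSpace.proj (𝕜 := ℝ) l).contDiff

lemma partialDeriv_radial {A : ℝ → ℝ} {A' : ℝ} {x : R3} (k : Fin 3)
    (hA : HasDerivAt A A' (‖x‖ ^ 2)) :
    partialDeriv k (fun y => A (‖y‖ ^ 2)) x = 2 * A' * x k := by
  have h := hA.comp_hasFDerivAt x (hasStrictFDerivAt_norm_sq x).hasFDerivAt
  have h' : fderiv ℝ (fun y : R3 => A (‖y‖ ^ 2)) x = _ := h.fderiv
  rw [partialDeriv, h']
  simp [EuclideanSpace.inner_single_right]
  ring

lemma partialDeriv_comp_clm {φ : R3 → C2} (hφ : ContDiff ℝ (⊤ : ℕ∞) φ) (L : C2 →L[ℝ] ℝ)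
    (k : Fin 3) (x : R3) : partialDeriv k (fun y => L (φ y)) x = L (pd φ k x) := by
  have h : fderiv ℝ (fun y => L (φ y)) x = _ :=
    (L.hasFDerivAt.comp x (hφ.differentiable (by simp) x).hasFDerivAt).fderiv
  rw [partialDeriv, h]
  rfl

/-- The regularized radius `√(|x|² + ε²)`. -/
def softRadius (ε : ℝ) (x : R3) : ℝ := √(‖x‖ ^ 2 + ε ^ 2)

section SoftRadius

variable {ε : ℝ}

lemma softRadius_pos (hε : ε ≠ 0) (x : R3) : 0 < softRadius ε x :=
  Real.sqrt_pos.2 (by positivity)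

lemma norm_sq_le_softRadius_sq (x : R3) : ‖x‖ ^ 2 ≤ softRadius ε x ^ 2 := by
  rw [softRadius, Real.sq_sqrt (by positivity)]
  nlinarith [sq_nonneg ε]

lemma contDiff_softRadius (hε : ε ≠ 0) : ContDiff ℝ (⊤ : ℕ∞) (softRadius ε) :=
  ((contDiff_norm_sq ℝ).add contDiff_const).sqrt fun x => by positivity

lemma hasDerivAt_sqrt_add {t : ℝ} (ht : 0 ≤ t) (hε : ε ≠ 0) :
    HasDerivAt (fun t => √(t + ε ^ 2)) (1 / (2 * √(t + ε ^ 2))) t :=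
  ((hasDerivAt_id t).add_const (ε ^ 2)).sqrt (by simp only [id]; positivity)

lemma partialDeriv_inv_softRadius (hε : ε ≠ 0) (k : Fin 3) (x : R3) :
    partialDeriv k (fun y => (softRadius ε y)⁻¹) x = -(x k / softRadius ε x ^ 3) := by
  have hρ := softRadius_pos hε x
  have h := partialDeriv_radial k
    ((hasDerivAt_sqrt_add (sq_nonneg ‖x‖) hε).inv (Real.sqrt_pos.2 (by positivity)).ne')
  refine h.trans ?_
  change 2 * (-(1 / (2 * softRadius ε x)) / softRadius ε x ^ 2) * x k = _
  field_simp

variable {ν s : ℝ}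

lemma weight_pos (hν : 0 ≤ ν) (hs : 0 ≤ s) (hε : ε ≠ 0) (x : R3) :
    0 < ν / softRadius ε x + 1 + s := by
  have := softRadius_pos hε x
  positivity

lemma contDiff_weight (hν : 0 ≤ ν) (hs : 0 ≤ s) (hε : ε ≠ 0) :
    ContDiff ℝ (⊤ : ℕ∞) (fun x => (ν / softRadius ε x + 1 + s)⁻¹) :=
  (((contDiff_const.div (contDiff_softRadius hε) fun x => (softRadius_pos hε x).ne').add
    contDiff_const).add contDiff_const).inv fun x => (weight_pos hν hs hε x).ne'

lemma partialDeriv_weight (hν : 0 ≤ ν) (hs : 0 ≤ s) (hε : ε ≠ 0) (k : Fin 3) (x : R3) :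
    partialDeriv k (fun y => (ν / softRadius ε y + 1 + s)⁻¹) x
      = ν / (softRadius ε x ^ 3 * (ν / softRadius ε x + 1 + s) ^ 2) * x k := by
  have hρ := softRadius_pos hε x
  have hm := weight_pos hν hs hε x
  have h := partialDeriv_radial k (((((hasDerivAt_sqrt_add (sq_nonneg ‖x‖) hε).inv
    (Real.sqrt_pos.2 (by positivity)).ne').const_mul ν).add_const 1).add_const s |>.inv
      (by rw [div_eq_mul_inv] at hm; exact hm.ne'))
  have h' : partialDeriv k (fun y => (ν / softRadius ε y + 1 + s)⁻¹) x
      = 2 * (-(ν * (-(1 / (2 * softRadius ε x)) / softRadius ε x ^ 2))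
        / (ν * (softRadius ε x)⁻¹ + 1 + s) ^ 2) * x k := by
    simp only [div_eq_mul_inv ν]
    exact h
  rw [h', ← div_eq_mul_inv ν]
  field_simp

/-- The regularized analogue of `x_l / (ν / |x| + 1 + s)`. -/
def weightedCoord (ν s ε : ℝ) (l : Fin 3) (x : R3) : ℝ :=
  (ν / softRadius ε x + 1 + s)⁻¹ * x l

lemma contDiff_weightedCoord (hν : 0 ≤ ν) (hs : 0 ≤ s) (hε : ε ≠ 0) (l : Fin 3) :
    ContDiff ℝ (⊤ : ℕ∞) (weightedCoord ν s ε l) :=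
  (contDiff_weight hν hs hε).mul (contDiff_coord l)

lemma partialDeriv_weightedCoord (hν : 0 ≤ ν) (hs : 0 ≤ s) (hε : ε ≠ 0) (k l : Fin 3)
    (x : R3) :
    partialDeriv k (weightedCoord ν s ε l) x
      = ν / (softRadius ε x ^ 3 * (ν / softRadius ε x + 1 + s) ^ 2) * x k * x l
        + 1 / (ν / softRadius ε x + 1 + s) * (if l = k then 1 else 0) := by
  have h := partialDeriv_mul k ((contDiff_weight hν hs hε).differentiable (by simp) x)
    ((contDiff_coord l).differentiable (by simp) x)
  rw [partialDeriv_weight hν hs hε, partialDeriv_coord] at h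
  rw [one_div]
  exact h

lemma partialDeriv_radial_field (hε : ε ≠ 0) {f : R3 → ℝ} (hf : ContDiff ℝ (⊤ : ℕ∞) f)
    (k : Fin 3) (x : R3) :
    partialDeriv k (fun y => (softRadius ε y)⁻¹ * y k * (f y * f y)) x
      = (1 / softRadius ε x - x k ^ 2 / softRadius ε x ^ 3) * f x ^ 2
        + 2 / softRadius ε x * (f x * (x k * partialDeriv k f x)) := by
  have dρ : DifferentiableAt ℝ (fun y => (softRadius ε y)⁻¹) x :=
    ((contDiff_softRadius hε).inv fun x => (softRadius_pos hε x).ne').differentiable (by simp) x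
  have dk := (contDiff_coord k).differentiable (by simp) x
  have df : DifferentiableAt ℝ f x := hf.differentiable (by simp) x
  rw [partialDeriv_mul k (dρ.fun_mul dk) (df.fun_mul df), partialDeriv_mul k dρ dk,
    partialDeriv_mul k df df, partialDeriv_inv_softRadius hε, partialDeriv_coord]
  simp
  ring

/-- The divergence of the vector field `f² x / √(|x|² + ε²)`. -/
def radialDiv (ε : ℝ) (f : R3 → ℝ) (x : R3) : ℝ :=
  ∑ k : Fin 3, partialDeriv k (fun y => (softRadius ε y)⁻¹ * y k * (f y * f y)) x

lemma radialDiv_eq (hε : ε ≠ 0) {f : R3 → ℝ} (hf : ContDiff ℝ (⊤ : ℕ∞) f) (x : R3) :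
    radialDiv ε f x
      = (3 / softRadius ε x - (x 0 ^ 2 + x 1 ^ 2 + x 2 ^ 2) / softRadius ε x ^ 3) * f x ^ 2
        + 2 / softRadius ε x * (f x * (x 0 * partialDeriv 0 f x + x 1 * partialDeriv 1 f x
          + x 2 * partialDeriv 2 f x)) := by
  simp only [radialDiv, partialDeriv_radial_field hε hf, Fin.sum_univ_three]
  ring

lemma integrable_and_integral_radialDiv (hε : ε ≠ 0) {f : R3 → ℝ}
    (hf : ContDiff ℝ (⊤ : ℕ∞) f) (hc : HasCompactSupport f) :
    Integrable (radialDiv ε f) ∧ ∫ x, radialDiv ε f x = 0 := by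
  have hs : ∀ k : Fin 3, ContDiff ℝ (⊤ : ℕ∞)
      (fun y => (softRadius ε y)⁻¹ * y k * (f y * f y)) := fun k =>
    (((contDiff_softRadius hε).inv fun x => (softRadius_pos hε x).ne').mul
      (contDiff_coord k)).mul (hf.mul hf)
  have hsc : ∀ k : Fin 3, HasCompactSupport
      (fun y => (softRadius ε y)⁻¹ * y k * (f y * f y)) := fun k =>
    (hc.mul_right (f' := f)).mul_left
  have hi := fun k => integrable_partialDeriv (hs k) (hsc k) k
  refine ⟨integrable_finsetSum _ fun k _ => hi k, ?_⟩
  unfold radialDiv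
  rw [integral_finsetSum _ fun k _ => hi k]
  exact Finset.sum_eq_zero fun k _ => integral_partialDeriv (hs k) (hsc k) k

end SoftRadius

/-- The real part of the `i`-th component of a spinor. -/
def reCoord (i : Fin 2) : C2 →L[ℝ] ℝ :=
  Complex.reCLM.comp ((EuclideanSpace.proj (𝕜 := ℂ) i).restrictScalars ℝ)

/-- The imaginary part of the `i`-th component of a spinor. -/
def imCoord (i : Fin 2) : C2 →L[ℝ] ℝ :=
  Complex.imCLM.comp ((EuclideanSpace.proj (𝕜 := ℂ) i).restrictScalars ℝ)

lemma norm_sq_eq_coords (z : C2) :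
    ‖z‖ ^ 2 = reCoord 0 z ^ 2 + imCoord 0 z ^ 2 + reCoord 1 z ^ 2 + imCoord 1 z ^ 2 := by
  rw [EuclideanSpace.norm_sq_eq, Fin.sum_univ_two, Complex.sq_norm, Complex.sq_norm,
    Complex.normSq_apply, Complex.normSq_apply]
  change _ = (z 0).re ^ 2 + (z 0).im ^ 2 + (z 1).re ^ 2 + (z 1).im ^ 2
  ring

lemma norm_sigmaGrad_sq {φ : R3 → C2} (hφ : ContDiff ℝ (⊤ : ℕ∞) φ) (x : R3) :
    ‖sigmaGrad φ x‖ ^ 2 =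
      (partialDeriv 0 (fun y => reCoord 1 (φ y)) x + partialDeriv 1 (fun y => imCoord 1 (φ y)) x
          + partialDeriv 2 (fun y => reCoord 0 (φ y)) x) ^ 2
        + (partialDeriv 0 (fun y => imCoord 1 (φ y)) x
          - partialDeriv 1 (fun y => reCoord 1 (φ y)) x
          + partialDeriv 2 (fun y => imCoord 0 (φ y)) x) ^ 2
        + (partialDeriv 0 (fun y => reCoord 0 (φ y)) x
          - partialDeriv 1 (fun y => imCoord 0 (φ y)) x
          - partialDeriv 2 (fun y => reCoord 1 (φ y)) x) ^ 2
        + (partialDeriv 0 (fun y => imCoord 0 (φ y)) x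
          + partialDeriv 1 (fun y => reCoord 0 (φ y)) x
          - partialDeriv 2 (fun y => imCoord 1 (φ y)) x) ^ 2 := by
  simp only [partialDeriv_comp_clm hφ]
  rw [EuclideanSpace.norm_sq_eq, Fin.sum_univ_two, Complex.sq_norm, Complex.sq_norm,
    Complex.normSq_apply, Complex.normSq_apply]
  simp [sigmaGrad, reCoord, imCoord]
  ring

/-- The null Lagrangian by which `|(σ·∇)φ|² / (ν / ρ + 1 + s)` differs from a quadratic form
controlled by the radial derivative, with `φ = (p + i q, u + i v)`. -/
def nullLagrangian (ν s ε : ℝ) (p q u v : R3 → ℝ) (x : R3) : ℝ :=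
  2 * (jacobian (weightedCoord ν s ε 2) u v x - jacobian (weightedCoord ν s ε 2) p q x
    + jacobian (weightedCoord ν s ε 1) p u x + jacobian (weightedCoord ν s ε 1) q v x
    - jacobian (weightedCoord ν s ε 0) p v x + jacobian (weightedCoord ν s ε 0) q u x)

lemma integrable_and_integral_nullLagrangian {ν s ε : ℝ} (hν : 0 ≤ ν) (hs : 0 ≤ s)
    (hε : ε ≠ 0) {p q u v : R3 → ℝ} (hp : ContDiff ℝ (⊤ : ℕ∞) p) (hq : ContDiff ℝ (⊤ : ℕ∞) q)
    (hu : ContDiff ℝ (⊤ : ℕ∞) u) (hv : ContDiff ℝ (⊤ : ℕ∞) v) (cp : HasCompactSupport p)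
    (cq : HasCompactSupport q) (cu : HasCompactSupport u) :
    Integrable (nullLagrangian ν s ε p q u v) ∧ ∫ x, nullLagrangian ν s ε p q u v x = 0 := by
  have hw := contDiff_weightedCoord hν hs hε
  obtain ⟨i1, e1⟩ := integrable_and_integral_jacobian (hw 2) hu hv cu
  obtain ⟨i2, e2⟩ := integrable_and_integral_jacobian (hw 2) hp hq cp
  obtain ⟨i3, e3⟩ := integrable_and_integral_jacobian (hw 1) hp hu cp
  obtain ⟨i4, e4⟩ := integrable_and_integral_jacobian (hw 1) hq hv cq
  obtain ⟨i5, e5⟩ := integrable_and_integral_jacobian (hw 0) hp hv cp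
  obtain ⟨i6, e6⟩ := integrable_and_integral_jacobian (hw 0) hq hu cq
  have j2 := i1.sub i2
  have j3 := j2.add i3
  have j4 := j3.add i4
  have j5 := j4.sub i5
  refine ⟨(j5.add i6).const_mul 2, ?_⟩
  unfold nullLagrangian
  rw [integral_const_mul, integral_add (f := fun x => _ - _) j5 i6,
    integral_sub (f := fun x => _ + _) j4 i5, integral_add (f := fun x => _ + _) j3 i4,
    integral_add (f := fun x => _ - _) j2 i3, integral_sub i1 i2, e1, e2, e3, e4, e5, e6]
  simp

set_option maxHeartbeats 1000000 in
lemma pointwise_bound {ν s ε : ℝ} (hν : 0 ≤ ν) (hs : 0 ≤ s) (hνs : ν ^ 2 = 1 - s ^ 2)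
    (hε : ε ≠ 0) {φ : R3 → C2} (hφ : ContDiff ℝ (⊤ : ℕ∞) φ) (x : R3) :
    ν * (‖φ x‖ ^ 2 / softRadius ε x) + s * ‖φ x‖ ^ 2 ≤
      ‖sigmaGrad φ x‖ ^ 2 / (ν / softRadius ε x + 1 + s) + ‖φ x‖ ^ 2
      - nullLagrangian ν s ε (fun y => reCoord 0 (φ y)) (fun y => imCoord 0 (φ y))
          (fun y => reCoord 1 (φ y)) (fun y => imCoord 1 (φ y)) x
      + ν / (1 + s) * (radialDiv ε (fun y => reCoord 0 (φ y)) x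
        + radialDiv ε (fun y => imCoord 0 (φ y)) x + radialDiv ε (fun y => reCoord 1 (φ y)) x
        + radialDiv ε (fun y => imCoord 1 (φ y)) x) := by
  have hr := norm_sq_le_softRadius_sq (ε := ε) x
  rw [EuclideanSpace.real_norm_sq_eq, Fin.sum_univ_three] at hr
  have hL : ∀ L : C2 →L[ℝ] ℝ, ContDiff ℝ (⊤ : ℕ∞) (fun y => L (φ y)) := fun L =>
    L.contDiff.comp hφ
  rw [norm_sigmaGrad_sq hφ, norm_sq_eq_coords, radialDiv_eq hε (hL _), radialDiv_eq hε (hL _),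
    radialDiv_eq hε (hL _), radialDiv_eq hε (hL _)]
  simp only [nullLagrangian, jacobian, partialDeriv_weightedCoord hν hs hε]
  have hρ := softRadius_pos hε x
  generalize softRadius ε x = ρ at *
  generalize reCoord 0 (φ x) = p, imCoord 0 (φ x) = q, reCoord 1 (φ x) = u,
    imCoord 1 (φ x) = v
  generalize partialDeriv 0 (fun y => reCoord 0 (φ y)) x = p1,
    partialDeriv 1 (fun y => reCoord 0 (φ y)) x = p2,
    partialDeriv 2 (fun y => reCoord 0 (φ y)) x = p3,
    partialDeriv 0 (fun y => imCoord 0 (φ y)) x = q1,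
    partialDeriv 1 (fun y => imCoord 0 (φ y)) x = q2,
    partialDeriv 2 (fun y => imCoord 0 (φ y)) x = q3,
    partialDeriv 0 (fun y => reCoord 1 (φ y)) x = u1,
    partialDeriv 1 (fun y => reCoord 1 (φ y)) x = u2,
    partialDeriv 2 (fun y => reCoord 1 (φ y)) x = u3,
    partialDeriv 0 (fun y => imCoord 1 (φ y)) x = v1,
    partialDeriv 1 (fun y => imCoord 1 (φ y)) x = v2,
    partialDeriv 2 (fun y => imCoord 1 (φ y)) x = v3
  generalize x 0 = x, x 1 = y, x 2 = z at *
  have hT := null_form_le_tangential x y z p1 p2 p3 q1 q2 q3 u1 u2 u3 v1 v2 v3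
  have hP : (x * p1 + y * p2 + z * p3) ^ 2 + (x * q1 + y * q2 + z * q3) ^ 2
      + (x * u1 + y * u2 + z * u3) ^ 2 + (x * v1 + y * v2 + z * v3) ^ 2
      ≤ (x ^ 2 + y ^ 2 + z ^ 2) * (p1 ^ 2 + p2 ^ 2 + p3 ^ 2 + q1 ^ 2 + q2 ^ 2 + q3 ^ 2
          + u1 ^ 2 + u2 ^ 2 + u3 ^ 2 + v1 ^ 2 + v2 ^ 2 + v3 ^ 2) := by
    have cs : ∀ b c d : ℝ, (x * b + y * c + z * d) ^ 2
        ≤ (x ^ 2 + y ^ 2 + z ^ 2) * (b ^ 2 + c ^ 2 + d ^ 2) := fun b c d => by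
      nlinarith [sq_nonneg (x * c - y * b), sq_nonneg (x * d - z * b), sq_nonneg (y * d - z * c)]
    linarith [cs p1 p2 p3, cs q1 q2 q3, cs u1 u2 u3, cs v1 v2 v3]
  obtain ⟨m, hm⟩ : ∃ m, m = ν / ρ + 1 + s := ⟨_, rfl⟩
  obtain ⟨c, hc⟩ : ∃ c, c = ν / (1 + s) := ⟨_, rfl⟩
  obtain ⟨w, hw⟩ : ∃ w, w = ν / (ρ ^ 3 * m ^ 2) := ⟨_, rfl⟩
  obtain ⟨a, ha⟩ : ∃ a, a = 1 / m := ⟨_, rfl⟩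
  have hsq := radial_square_bound (c := c) (N := p ^ 2 + q ^ 2 + u ^ 2 + v ^ 2)
    (Y := p * (x * p1 + y * p2 + z * p3) + q * (x * q1 + y * q2 + z * q3)
      + u * (x * u1 + y * u2 + z * u3) + v * (x * v1 + y * v2 + z * v3))
    hρ hr hν hs hm ha hw (by rw [hc]; field_simp) hνs (by positivity) (by positivity) hP hT
    (by
      have : 0 ≤ ((x * p1 + y * p2 + z * p3) + c * ρ * m * p) ^ 2
        + ((x * q1 + y * q2 + z * q3) + c * ρ * m * q) ^ 2
        + ((x * u1 + y * u2 + z * u3) + c * ρ * m * u) ^ 2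
        + ((x * v1 + y * v2 + z * v3) + c * ρ * m * v) ^ 2 := by positivity
      refine this.trans_eq ?_
      ring)
  rw [← hm, ← hw, ← ha, ← hc, div_eq_mul_one_div _ m, ← ha]
  simp only [reduceIte, Fin.reduceEq]
  refine le_of_eq_of_le ?_ (hsq.trans_eq ?_)
  · ring
  · ring

lemma integrable_norm_sigmaGrad_sq {φ : R3 → C2} (hφ : IsCc φ) :
    Integrable (fun x => ‖sigmaGrad φ x‖ ^ 2) := by
  have hL : ∀ (L : C2 →L[ℝ] ℝ) (k : Fin 3), Continuous (partialDeriv k (fun y => L (φ y))) :=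
    fun L k => (contDiff_partialDeriv (L.contDiff.comp hφ.1) k).continuous
  refine Continuous.integrable_of_hasCompactSupport ?_ ?_
  · simp only [norm_sigmaGrad_sq hφ.1]
    exact ((((((hL _ _).add (hL _ _)).add (hL _ _)).pow 2).add
      ((((hL _ _).sub (hL _ _)).add (hL _ _)).pow 2)).add
      ((((hL _ _).sub (hL _ _)).sub (hL _ _)).pow 2)).add
      ((((hL _ _).add (hL _ _)).sub (hL _ _)).pow 2)
  · refine (hφ.2.fderiv (𝕜 := ℝ)).mono fun x hx h0 => hx ?_
    have hpd : ∀ k, pd φ k x = 0 := fun k => by rw [pd, h0]; rfl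
    simp [norm_sigmaGrad_sq hφ.1, partialDeriv_comp_clm hφ.1, hpd]

lemma integrable_norm_sq {φ : R3 → C2} (hφ : IsCc φ) : Integrable (fun x => ‖φ x‖ ^ 2) :=
  (hφ.1.continuous.norm.pow 2).integrable_of_hasCompactSupport
    (hφ.2.mono fun x hx h0 => hx (by simp [h0]))

lemma integrable_norm_sigmaGrad_sq_div {ν s ε : ℝ} (hν : 0 ≤ ν) (hs : 0 ≤ s) (hε : ε ≠ 0)
    {φ : R3 → C2} (hφ : IsCc φ) :
    Integrable (fun x => ‖sigmaGrad φ x‖ ^ 2 / (ν / softRadius ε x + 1 + s)) := by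
  refine (integrable_norm_sigmaGrad_sq hφ).mono' ?_ (.of_forall fun x => ?_)
  · simp only [div_eq_mul_inv _ (_ + s)]
    exact (integrable_norm_sigmaGrad_sq hφ).aestronglyMeasurable.mul
      (contDiff_weight hν hs hε).continuous.aestronglyMeasurable
  · have := softRadius_pos hε x
    rw [Real.norm_of_nonneg (by positivity)]
    refine div_le_self (by positivity) ?_
    have : 0 ≤ ν / softRadius ε x := by positivity
    linarith

lemma integrable_norm_sq_div {ε : ℝ} (hε : ε ≠ 0) {φ : R3 → C2} (hφ : IsCc φ) :
    Integrable (fun x => ‖φ x‖ ^ 2 / softRadius ε x) := by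
  refine Continuous.integrable_of_hasCompactSupport ?_
    (hφ.2.mono fun x hx h0 => hx (by simp [h0]))
  exact (hφ.1.continuous.norm.pow 2).div (contDiff_softRadius hε).continuous
    fun x => (softRadius_pos hε x).ne'

/-- The inequality with `|x|` replaced by `√(|x|² + ε²)`. -/
theorem regularized_hardy {ν s ε : ℝ} (hν : 0 ≤ ν) (hs : 0 ≤ s) (hνs : ν ^ 2 = 1 - s ^ 2)
    (hε : ε ≠ 0) {φ : R3 → C2} (hφ : IsCc φ) :
    ν * (∫ x : R3, ‖φ x‖ ^ 2 / softRadius ε x) + s * (∫ x : R3, ‖φ x‖ ^ 2) ≤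
      (∫ x : R3, ‖sigmaGrad φ x‖ ^ 2 / (ν / softRadius ε x + 1 + s)) + ∫ x : R3, ‖φ x‖ ^ 2 := by
  have hL : ∀ L : C2 →L[ℝ] ℝ, ContDiff ℝ (⊤ : ℕ∞) (fun y => L (φ y)) := fun L =>
    L.contDiff.comp hφ.1
  have hLc : ∀ L : C2 →L[ℝ] ℝ, HasCompactSupport (fun y => L (φ y)) := fun L =>
    hφ.2.comp_left (map_zero L)
  obtain ⟨iJ, eJ⟩ := integrable_and_integral_nullLagrangian hν hs hε (hL (reCoord 0))
    (hL (imCoord 0)) (hL (reCoord 1)) (hL (imCoord 1)) (hLc _) (hLc _) (hLc _)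
  have hR := fun L : C2 →L[ℝ] ℝ => integrable_and_integral_radialDiv hε (hL L) (hLc L)
  have iR2 := (hR (reCoord 0)).1.add (hR (imCoord 0)).1
  have iR3 := iR2.add (hR (reCoord 1)).1
  have iR := iR3.add (hR (imCoord 1)).1
  have i1 := integrable_norm_sigmaGrad_sq_div hν hs hε hφ
  have i2 := integrable_norm_sq hφ
  have i3 := integrable_norm_sq_div hε hφ
  have h := integral_mono ((i3.const_mul ν).add (i2.const_mul s))
    (((i1.add i2).sub iJ).add (iR.const_mul (ν / (1 + s))))
    (pointwise_bound hν hs hνs hε hφ.1)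
  rwa [integral_add' (i3.const_mul ν) (i2.const_mul s), integral_const_mul, integral_const_mul,
    integral_add' ((i1.add i2).sub iJ) (iR.const_mul (ν / (1 + s))),
    integral_sub' (i1.add i2) iJ, integral_add' i1 i2, integral_const_mul,
    integral_add' iR3 (hR (imCoord 1)).1, integral_add' iR2 (hR (reCoord 1)).1,
    integral_add' (hR (reCoord 0)).1 (hR (imCoord 0)).1, eJ, (hR _).2, (hR _).2, (hR _).2,
    (hR _).2, sub_zero, add_zero, add_zero, add_zero, mul_zero, add_zero] at h

lemma tendsto_softRadius (x : R3) :
    Filter.Tendsto (fun n : ℕ => softRadius (1 / ((n : ℝ) + 1)) x) Filter.atTop (nhds ‖x‖) := by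
  have h : Filter.Tendsto (fun n : ℕ => √(‖x‖ ^ 2 + (1 / ((n : ℝ) + 1)) ^ 2)) Filter.atTop
      (nhds (√(‖x‖ ^ 2 + 0 ^ 2))) :=
    (tendsto_const_nhds.add (tendsto_one_div_add_atTop_nhds_zero_nat.pow 2)).sqrt
  rwa [zero_pow two_ne_zero, add_zero, Real.sqrt_sq (norm_nonneg x)] at h

lemma tendsto_integral_norm_sigmaGrad_sq_div {ν s : ℝ} (hν : 0 ≤ ν) (hs : 0 ≤ s)
    {φ : R3 → C2} (hφ : IsCc φ) :
    Filter.Tendsto (fun n : ℕ => ∫ x : R3, ‖sigmaGrad φ x‖ ^ 2 /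
        (ν / softRadius (1 / ((n : ℝ) + 1)) x + 1 + s)) Filter.atTop
      (nhds (∫ x : R3, ‖sigmaGrad φ x‖ ^ 2 / (ν / ‖x‖ + 1 + s))) := by
  have hε : ∀ n : ℕ, (1 / ((n : ℝ) + 1)) ≠ 0 := fun n => by positivity
  refine tendsto_integral_of_dominated_convergence (fun x => ‖sigmaGrad φ x‖ ^ 2)
    (fun n => (integrable_norm_sigmaGrad_sq_div hν hs (hε n) hφ).aestronglyMeasurable)
    (integrable_norm_sigmaGrad_sq hφ) (fun n => .of_forall fun x => ?_) ?_
  · have := softRadius_pos (hε n) x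
    rw [Real.norm_of_nonneg (by positivity)]
    refine div_le_self (by positivity) ?_
    have : 0 ≤ ν / softRadius (1 / ((n : ℝ) + 1)) x := by positivity
    linarith
  · filter_upwards [Measure.ae_ne volume (0 : R3)] with x hx
    have hx' : 0 < ‖x‖ := norm_pos_iff.2 hx
    refine tendsto_const_nhds.div (((tendsto_const_nhds.div (tendsto_softRadius x)
      hx'.ne').add_const 1).add_const s) ?_
    positivity

lemma tendsto_integral_norm_sq_div {φ : R3 → C2} (hφ : IsCc φ)
    (hi : Integrable (fun x : R3 => ‖φ x‖ ^ 2 / ‖x‖)) :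
    Filter.Tendsto (fun n : ℕ => ∫ x : R3, ‖φ x‖ ^ 2 / softRadius (1 / ((n : ℝ) + 1)) x)
      Filter.atTop (nhds (∫ x : R3, ‖φ x‖ ^ 2 / ‖x‖)) := by
  have hε : ∀ n : ℕ, (1 / ((n : ℝ) + 1)) ≠ 0 := fun n => by positivity
  have h0 := Measure.ae_ne volume (0 : R3)
  refine tendsto_integral_of_dominated_convergence (fun x => ‖φ x‖ ^ 2 / ‖x‖)
    (fun n => (integrable_norm_sq_div (hε n) hφ).aestronglyMeasurable) hi (fun n => ?_) ?_
  · filter_upwards [h0] with x hx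
    have hx' : 0 < ‖x‖ := norm_pos_iff.2 hx
    have hρ := softRadius_pos (hε n) x
    rw [Real.norm_of_nonneg (by positivity)]
    have := abs_le_of_sq_le_sq' (norm_sq_le_softRadius_sq (ε := 1 / ((n : ℝ) + 1)) x) hρ.le
    gcongr
    exact this.2
  · filter_upwards [h0] with x hx
    exact tendsto_const_nhds.div (tendsto_softRadius x) (norm_pos_iff.2 hx).ne'

/-- Inhomogeneous Hardy-type inequality obtained from the Talman min-max principle. -/
theorem hardy_inhomogeneous (ν : ℝ) (hν : ν ∈ Set.Icc (0 : ℝ) 1)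
    (φ : R3 → C2) (hφ : IsCc φ) :
    ν * (∫ x : R3, ‖φ x‖ ^ 2 / ‖x‖) +
      Real.sqrt (1 - ν ^ 2) * (∫ x : R3, ‖φ x‖ ^ 2) ≤
    (∫ x : R3, ‖sigmaGrad φ x‖ ^ 2 / (ν / ‖x‖ + 1 + Real.sqrt (1 - ν ^ 2))) +
      ∫ x : R3, ‖φ x‖ ^ 2 := by
  obtain ⟨hν0, hν1⟩ := hν
  have hs : 0 ≤ √(1 - ν ^ 2) := Real.sqrt_nonneg _
  have hνs : ν ^ 2 = 1 - √(1 - ν ^ 2) ^ 2 := by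
    rw [Real.sq_sqrt (by nlinarith)]
    ring
  have hs1 : √(1 - ν ^ 2) ≤ 1 := Real.sqrt_le_one.2 (by nlinarith)
  by_cases hi : Integrable (fun x : R3 => ‖φ x‖ ^ 2 / ‖x‖)
  · exact le_of_tendsto_of_tendsto'
      (((tendsto_integral_norm_sq_div hφ hi).const_mul ν).add_const _)
      ((tendsto_integral_norm_sigmaGrad_sq_div hν0 hs hφ).add_const _)
      fun n => regularized_hardy hν0 hs hνs (by positivity) hφ
  · rw [integral_undef hi, mul_zero, zero_add]
    have h1 : 0 ≤ ∫ x : R3, ‖φ x‖ ^ 2 := integral_nonneg fun x => by positivity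
    have h2 : 0 ≤ ∫ x : R3, ‖sigmaGrad φ x‖ ^ 2 / (ν / ‖x‖ + 1 + √(1 - ν ^ 2)) :=
      integral_nonneg fun x => by positivity
    nlinarith
end
end

section
/- Let ν ∈ (0,1), c₁ ≥ 0, c₂ ≥ 0 with c₁ + c₂ − 1 < √(1−ν²), and let V : ℝ³ → ℝ be measurable with V(x) → 0 as |x| → ∞ and −ν/|x| − c₁ ≤ V(x) ≤ c₂ for a.e. x. Then for every nonzero φ ∈ C_c^∞(ℝ³, ℂ²) there exists a unique λ ∈ (c₂ − 1, +∞) such that λ ∫_{ℝ³} |φ(x)|² dx = ∫_{ℝ³} [ |((σ·∇)φ)(x)|²/(1 − V(x) + λ) + (1 + V(x))|φ(x)|² ] dx. -/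
open MeasureTheory Complex

noncomputable section

section

open scoped ComplexConjugate

theorem fourierCoeffOn_deriv_of_periodic {a b : ℝ} (hab : a < b) {f f' : ℝ → ℂ}
    (hf : ∀ t, HasDerivAt f (f' t) t) (hf' : Continuous f') (hper : f b = f a) (n : ℤ) :
    fourierCoeffOn hab f' n = 2 * Real.pi * I * n / (b - a) * fourierCoeffOn hab f n := by
  have hb : ((b : ℂ) - a) ≠ 0 := by
    rw [← ofReal_sub]; exact_mod_cast (sub_pos.2 hab).ne'
  rcases eq_or_ne n 0 with rfl | hn
  · have h := intervalIntegral.integral_eq_sub_of_hasDerivAt (fun t _ => hf t)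
      (hf'.intervalIntegrable a b)
    simp [fourierCoeffOn_eq_integral, h, hper]
  · rw [fourierCoeffOn_of_hasDerivAt hab hn (fun t _ => hf t) (hf'.intervalIntegrable a b)]
    have hn' : (n : ℂ) ≠ 0 := by exact_mod_cast hn
    have hpi : (Real.pi : ℂ) ≠ 0 := by exact_mod_cast Real.pi_ne_zero
    rw [hper]
    field_simp
    simp

/-- The operator `-i d/dt + 1/2` on `2π`-periodic functions has half-integer spectrum. -/
theorem integral_normSq_deriv_add_im_nonneg {f f' : ℝ → ℂ}
    (hf : ∀ t, HasDerivAt f (f' t) t) (hf' : Continuous f') (hper : f (2 * Real.pi) = f 0) :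
    0 ≤ ∫ t in (0 : ℝ)..(2 * Real.pi), (normSq (f' t) + (f' t * conj (f t)).im) := by
  have hab : (0 : ℝ) < 2 * Real.pi := Real.two_pi_pos
  have hfc : Continuous f := continuous_iff_continuousAt.2 fun t => (hf t).continuousAt
  set g : ℝ → ℂ := fun t => f' t + I / 2 * f t with hg
  have hgc : Continuous g := by fun_prop
  have hmem : ∀ u : ℝ → ℂ, Continuous u →
      MemLp u 2 (volume.restrict (Set.Ioc 0 (2 * Real.pi))) := fun u hu =>
    (memLp_two_iff_integrable_sq_norm hu.aestronglyMeasurable).2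
      ((hu.norm.pow 2).integrableOn_Ioc)
  have hcoeff : ∀ n : ℤ, fourierCoeffOn hab g n = (n + 1 / 2) * I * fourierCoeffOn hab f n := by
    intro n
    have h1 : fourierCoeffOn hab g n =
        fourierCoeffOn hab f' n + I / 2 * fourierCoeffOn hab f n := by
      simp only [fourierCoeffOn_eq_integral, hg, smul_add]
      rw [intervalIntegral.integral_add, smul_add]
      · congr 1
        rw [mul_smul_comm, ← intervalIntegral.integral_const_mul]
        congr 2
        ext t
        simp only [smul_eq_mul]; ring
      · exact Continuous.intervalIntegrable (by fun_prop) _ _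
      · exact Continuous.intervalIntegrable (by fun_prop) _ _
    rw [h1, fourierCoeffOn_deriv_of_periodic hab hf hf' hper]
    have hpi : (Real.pi : ℂ) ≠ 0 := by exact_mod_cast Real.pi_ne_zero
    push_cast
    field_simp
    ring
  have hle : ((2 * Real.pi - 0)⁻¹ • ∫ t in (0 : ℝ)..(2 * Real.pi), ‖f t‖ ^ 2) / 4 ≤
      (2 * Real.pi - 0)⁻¹ • ∫ t in (0 : ℝ)..(2 * Real.pi), ‖g t‖ ^ 2 := by
    refine hasSum_le (fun n => ?_) ((hasSum_sq_fourierCoeffOn hab (hmem f hfc)).div_const 4)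
      (hasSum_sq_fourierCoeffOn hab (hmem g hgc))
    rw [hcoeff, norm_mul, norm_mul, norm_I, mul_one, mul_pow]
    have hn : (1 / 4 : ℝ) ≤ ‖(n + 1 / 2 : ℂ)‖ ^ 2 := by
      have : (n + 1 / 2 : ℂ) = ((n + 1 / 2 : ℝ) : ℂ) := by push_cast; ring
      rw [this, norm_real, Real.norm_eq_abs, sq_abs]
      have : (0 : ℝ) ≤ n * (n + 1) := by
        have h : (0 : ℤ) ≤ n * (n + 1) := by
          rcases le_or_gt 0 n with h | h
          · positivity
          · exact mul_nonneg_of_nonpos_of_nonpos h.le (by omega)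
        exact_mod_cast h
      nlinarith
    nlinarith [sq_nonneg ‖fourierCoeffOn hab f n‖]
  have heq : ∀ t, normSq (f' t) + (f' t * conj (f t)).im = ‖g t‖ ^ 2 - ‖f t‖ ^ 2 / 4 := by
    intro t
    simp only [hg, ← normSq_eq_norm_sq, normSq_apply, add_re, add_im, mul_re, mul_im, conj_re,
      conj_im, div_ofNat_re, div_ofNat_im, I_re, I_im]
    ring
  simp only [heq]
  rw [intervalIntegral.integral_sub, intervalIntegral.integral_div]
  · rw [smul_eq_mul, smul_eq_mul, mul_div_assoc] at hle
    have := le_of_mul_le_mul_left hle (by positivity)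
    linarith
  · exact Continuous.intervalIntegrable (by fun_prop) _ _
  · exact Continuous.intervalIntegrable (by fun_prop) _ _

/-- The standard basis vectors of `ℝ³`. -/
def basisVec (i : Fin 3) : R3 := EuclideanSpace.single i 1

/-- The partial derivative `∂ᵢf` of a scalar function. -/
def pderiv (i : Fin 3) (f : R3 → ℂ) (x : R3) : ℂ := fderiv ℝ f x (basisVec i)

/-- The angular derivative `xₐ∂_b f - x_b∂ₐ f`. -/
def angDeriv (a b : Fin 3) (f : R3 → ℂ) (x : R3) : ℂ :=
  x a * pderiv b f x - x b * pderiv a f x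

/-- The rotation by the angle `t` in the oriented plane spanned by the `a`-th and `b`-th axes. -/
def planeRotation (a b : Fin 3) (t : ℝ) : R3 →ₗ[ℝ] R3 where
  toFun x := x + (Real.cos t - 1) • (x a • basisVec a + x b • basisVec b) +
    Real.sin t • (x a • basisVec b - x b • basisVec a)
  map_add' x y := by simp only [PiLp.add_apply]; module
  map_smul' c x := by simp only [PiLp.smul_apply, smul_eq_mul, RingHom.id_apply]; module

theorem planeRotation_apply (a b : Fin 3) (t : ℝ) (x : R3) :
    planeRotation a b t x = x + (Real.cos t - 1) • (x a • basisVec a + x b • basisVec b) +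
      Real.sin t • (x a • basisVec b - x b • basisVec a) := rfl

theorem norm_planeRotation {a b : Fin 3} (hab : a ≠ b) (t : ℝ) (x : R3) :
    ‖planeRotation a b t x‖ = ‖x‖ := by
  have h : ((x a) ^ 2 + (x b) ^ 2) * (Real.sin t ^ 2 + Real.cos t ^ 2) = (x a) ^ 2 + (x b) ^ 2 := by
    rw [Real.sin_sq_add_cos_sq, mul_one]
  rw [← sq_eq_sq₀ (norm_nonneg _) (norm_nonneg _), EuclideanSpace.norm_sq_eq,
    EuclideanSpace.norm_sq_eq]
  simp only [Fin.sum_univ_three, Real.norm_eq_abs, sq_abs, planeRotation_apply, basisVec,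
    PiLp.add_apply, PiLp.sub_apply, PiLp.smul_apply, smul_eq_mul, PiLp.single_apply]
  fin_cases a <;> fin_cases b <;> simp at hab ⊢ <;>
    simp only [Fin.zero_eta, Fin.mk_one, Fin.reduceFinMk] at h <;> linear_combination h

theorem planeRotation_apply_left {a b : Fin 3} (hab : a ≠ b) (t : ℝ) (x : R3) :
    planeRotation a b t x a = Real.cos t * x a - Real.sin t * x b := by
  simp [planeRotation_apply, basisVec, hab]
  ring

theorem planeRotation_apply_right {a b : Fin 3} (hab : a ≠ b) (t : ℝ) (x : R3) :
    planeRotation a b t x b = Real.cos t * x b + Real.sin t * x a := by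
  simp [planeRotation_apply, basisVec, hab.symm]
  ring

theorem hasDerivAt_planeRotation {a b : Fin 3} (hab : a ≠ b) (t : ℝ) (x : R3) :
    HasDerivAt (fun s => planeRotation a b s x)
      (planeRotation a b t x a • basisVec b - planeRotation a b t x b • basisVec a) t := by
  rw [planeRotation_apply_left hab, planeRotation_apply_right hab]
  have h := (((Real.hasDerivAt_cos t).sub_const 1).smul_const
    (x a • basisVec a + x b • basisVec b)).const_add x |>.add
    ((Real.hasDerivAt_sin t).smul_const (x a • basisVec b - x b • basisVec a))
  refine h.congr_deriv ?_
  module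

theorem measurePreserving_planeRotation {a b : Fin 3} (hab : a ≠ b) (t : ℝ) :
    MeasurePreserving (planeRotation a b t) (volume : Measure R3) volume :=
  (LinearIsometry.toLinearIsometryEquiv
    ⟨planeRotation a b t, norm_planeRotation hab t⟩ rfl).measurePreserving

theorem integral_comp_planeRotation {a b : Fin 3} (hab : a ≠ b) (t : ℝ) (f : R3 → ℝ) :
    ∫ x, f (planeRotation a b t x) = ∫ x, f x :=
  (measurePreserving_planeRotation hab t).integral_comp
    (LinearIsometry.toLinearIsometryEquiv
    ⟨planeRotation a b t, norm_planeRotation hab t⟩ rfl).toHomeomorph.measurableEmbedding f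

theorem continuous_planeRotation (a b : Fin 3) :
    Continuous fun p : ℝ × R3 => planeRotation a b p.1 p.2 := by
  simp only [planeRotation_apply]
  fun_prop

theorem continuous_pderiv {f : R3 → ℂ} (hf : ContDiff ℝ 1 f) (i : Fin 3) :
    Continuous (pderiv i f) :=
  (hf.continuous_fderiv one_ne_zero).clm_apply continuous_const

theorem continuous_angDeriv {f : R3 → ℂ} (hf : ContDiff ℝ 1 f) (a b : Fin 3) :
    Continuous (angDeriv a b f) := by
  have := continuous_pderiv hf a
  have := continuous_pderiv hf b
  unfold angDeriv
  fun_prop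

theorem pderiv_eq_zero {f : R3 → ℂ} {x : R3} (hx : x ∉ tsupport f) (i : Fin 3) :
    pderiv i f x = 0 := by
  have : fderiv ℝ f x = 0 := by
    by_contra h
    exact hx (support_fderiv_subset ℝ h)
  simp [pderiv, this]

/-- If a group of rotations acts on a compactly supported function and all its
orbit averages are nonnegative, then so is its integral. -/
theorem integral_nonneg_of_planeRotation {a b : Fin 3} (hab : a ≠ b) {F : R3 → ℝ}
    (hF : Continuous F) (hFs : HasCompactSupport F)
    (h : ∀ x, 0 ≤ ∫ t in (0 : ℝ)..(2 * Real.pi), F (planeRotation a b t x)) :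
    0 ≤ ∫ x, F x := by
  obtain ⟨r, hr⟩ := hFs.isCompact.isBounded.subset_closedBall 0
  have hzero : ∀ x : R3, x ∉ Metric.closedBall (0 : R3) r → F x = 0 := fun x hx =>
    image_eq_zero_of_notMem_tsupport fun hx' => hx (hr hx')
  have hzero' : ∀ t, ∀ x : R3, x ∉ Metric.closedBall (0 : R3) r →
      F (planeRotation a b t x) = 0 := fun t x hx => hzero _ (by
    simpa [norm_planeRotation hab] using hx)
  have hcont : Continuous (Function.uncurry fun (t : ℝ) (x : R3) => F (planeRotation a b t x)) :=
    hF.comp (continuous_planeRotation a b)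
  have hswap : ∫ t in (0 : ℝ)..(2 * Real.pi), ∫ x in Metric.closedBall (0 : R3) r,
        F (planeRotation a b t x) =
      ∫ x in Metric.closedBall (0 : R3) r, ∫ t in (0 : ℝ)..(2 * Real.pi),
        F (planeRotation a b t x) := by
    simp only [intervalIntegral.integral_of_le Real.two_pi_pos.le]
    refine integral_integral_swap ?_
    rw [Measure.prod_restrict]
    exact (hcont.continuousOn.integrableOn_compact
      (isCompact_Icc.prod (isCompact_closedBall (0 : R3) r))).mono_set
      (Set.prod_mono_left Set.Ioc_subset_Icc_self)
  have hconst : ∀ t, ∫ x in Metric.closedBall (0 : R3) r, F (planeRotation a b t x) =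
      ∫ x, F x := fun t => by
    rw [setIntegral_eq_integral_of_forall_compl_eq_zero (hzero' t),
      integral_comp_planeRotation hab]
  simp only [hconst, intervalIntegral.integral_const, sub_zero, smul_eq_mul] at hswap
  have : 0 ≤ 2 * Real.pi * ∫ x, F x := hswap ▸ integral_nonneg h
  exact (mul_nonneg_iff_of_pos_left Real.two_pi_pos).1 this

theorem integral_radial_mul_angDeriv_nonneg {a b : Fin 3} (hab : a ≠ b) {f : R3 → ℂ}
    (hf : ContDiff ℝ 1 f) (hfs : HasCompactSupport f) {g : R3 → ℝ} (hg : Continuous g)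
    (hg0 : ∀ x, 0 ≤ g x) (hgr : ∀ x y, ‖x‖ = ‖y‖ → g x = g y) :
    0 ≤ ∫ x, g x * (normSq (angDeriv a b f x) + (angDeriv a b f x * conj (f x)).im) := by
  have hD := continuous_angDeriv hf a b
  have hfc := hf.continuous
  refine integral_nonneg_of_planeRotation hab ?_ ?_ fun x => ?_
  · generalize angDeriv a b f = D at hD
    exact hg.mul ((continuous_normSq.comp hD).add
      (continuous_im.comp (hD.mul (continuous_conj.comp hfc))))
  · refine HasCompactSupport.intro hfs.isCompact fun x hx => ?_
    simp [angDeriv, pderiv_eq_zero hx]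
  · have hgx : ∀ t, g (planeRotation a b t x) = g x := fun t => hgr _ _ (norm_planeRotation hab t x)
    simp only [hgx, intervalIntegral.integral_const_mul]
    refine mul_nonneg (hg0 x) ?_
    have hR : Continuous fun t => planeRotation a b t x := by
      simp only [planeRotation_apply]
      fun_prop
    have hderiv : ∀ t, HasDerivAt (fun t => f (planeRotation a b t x))
        (angDeriv a b f (planeRotation a b t x)) t := fun t => by
      have hd : HasFDerivAt f (fderiv ℝ f (planeRotation a b t x)) (planeRotation a b t x) :=
        (hf.differentiable one_ne_zero _).hasFDerivAt
      have h := HasFDerivAt.comp_hasDerivAt (f := fun s => planeRotation a b s x) t hd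
        (hasDerivAt_planeRotation hab t x)
      refine h.congr_deriv ?_
      simp only [angDeriv, pderiv, map_sub, map_smul, real_smul]
    exact integral_normSq_deriv_add_im_nonneg hderiv (hD.comp hR) (by simp [planeRotation_apply])

theorem contDiff_pderiv {f : R3 → ℂ} (hf : ContDiff ℝ 2 f) (i : Fin 3) :
    ContDiff ℝ 1 (pderiv i f) :=
  (hf.fderiv_right (m := 1) (by norm_num)).clm_apply contDiff_const

theorem pderiv_comm {f : R3 → ℂ} (hf : ContDiff ℝ 2 f) (a b : Fin 3) (x : R3) :
    pderiv a (pderiv b f) x = pderiv b (pderiv a f) x := by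
  have hd : DifferentiableAt ℝ (fderiv ℝ f) x :=
    (hf.fderiv_right (m := 1) (by norm_num)).differentiable one_ne_zero x
  have hsymm : IsSymmSndFDerivAt ℝ f x := hf.contDiffAt.isSymmSndFDerivAt (by simp)
  have h : ∀ i j : Fin 3, pderiv i (pderiv j f) x =
      fderiv ℝ (fderiv ℝ f) x (basisVec i) (basisVec j) := fun i j => by
    have hj : pderiv j f = fun y => fderiv ℝ f y (basisVec j) := rfl
    rw [pderiv, hj, fderiv_clm_apply hd (differentiableAt_const _)]
    simp
  rw [h, h, hsymm.eq]

theorem pderiv_conj {f : R3 → ℂ} (hf : ContDiff ℝ 1 f) (i : Fin 3) (x : R3) :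
    pderiv i (fun y => conj (f y)) x = conj (pderiv i f x) := by
  have h := (conjCLE : ℂ ≃L[ℝ] ℂ).toContinuousLinearMap.hasFDerivAt.comp x
    (hf.differentiable one_ne_zero x).hasFDerivAt
  have h' : fderiv ℝ (fun y => conj (f y)) x = _ := h.fderiv
  rw [pderiv, h']
  simp [pderiv]

theorem pderiv_ofReal_mul {h : R3 → ℝ} {f : R3 → ℂ} (hh : ContDiff ℝ 1 h) (hf : ContDiff ℝ 1 f)
    (i : Fin 3) (x : R3) :
    pderiv i (fun y => h y * f y) x =
      fderiv ℝ h x (basisVec i) * f x + h x * pderiv i f x := by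
  have h1 := (hh.differentiable one_ne_zero x).hasFDerivAt.smul
    (hf.differentiable one_ne_zero x).hasFDerivAt
  have h' : fderiv ℝ (fun y => (h y : ℂ) * f y) x = _ := h1.fderiv
  rw [pderiv, h']
  simp [pderiv]
  ring

theorem integral_conj_pderiv_mul {f F : R3 → ℂ} (hf : ContDiff ℝ 1 f) (hfs : HasCompactSupport f)
    (hF : ContDiff ℝ 1 F) (i : Fin 3) :
    ∫ x, conj (pderiv i f x) * F x = -∫ x, conj (f x) * pderiv i F x := by
  have hc : ContDiff ℝ 1 fun y => conj (f y) :=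
    (conjCLE : ℂ ≃L[ℝ] ℂ).toContinuousLinearMap.contDiff.comp hf
  have hz : ∀ x, x ∉ tsupport f → f x = 0 := fun x => image_eq_zero_of_notMem_tsupport
  have hFi := continuous_pderiv hF i
  have hfi := continuous_pderiv hf i
  have h := integral_mul_fderiv_eq_neg_fderiv_mul_of_integrable (𝕜 := ℂ)
    (μ := (volume : Measure R3)) (f := fun y => conj (f y)) (g := F) (v := basisVec i) ?_ ?_ ?_
    (fun x _ => hc.differentiable one_ne_zero x) (fun x _ => hF.differentiable one_ne_zero x)
  · have h2 : ∀ x, fderiv ℝ (fun y => conj (f y)) x (basisVec i) = conj (pderiv i f x) :=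
      pderiv_conj hf i
    simp only [h2] at h
    rw [eq_neg_iff_add_eq_zero, add_comm, ← eq_neg_iff_add_eq_zero]
    exact h
  · have h2 : ∀ x, fderiv ℝ (fun y => conj (f y)) x (basisVec i) = conj (pderiv i f x) :=
      pderiv_conj hf i
    simp only [h2]
    exact ((continuous_conj.comp hfi).mul hF.continuous).integrable_of_hasCompactSupport
      (HasCompactSupport.intro hfs.isCompact fun x hx => by simp [pderiv_eq_zero hx])
  · exact (hc.continuous.mul hFi).integrable_of_hasCompactSupport
      (HasCompactSupport.intro hfs.isCompact fun x hx => by simp [hz x hx])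
  · exact (hc.continuous.mul hF.continuous).integrable_of_hasCompactSupport
      (HasCompactSupport.intro hfs.isCompact fun x hx => by simp [hz x hx])

/-- Integration by parts of the null form `Im(∂ₐf · conj ∂_b f)` against a radial weight. -/
theorem integral_nullForm_eq {f : R3 → ℂ} (hf : ContDiff ℝ 2 f) (hfs : HasCompactSupport f)
    {h g : R3 → ℝ} (hh : ContDiff ℝ 1 h) (hg : Continuous g)
    (hhg : ∀ x i, fderiv ℝ h x (basisVec i) = g x * x i) (a b : Fin 3) :
    ∫ x, h x * (2 * (pderiv a f x * conj (pderiv b f x)).im) =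
      ∫ x, g x * (angDeriv a b f x * conj (f x)).im := by
  have hf1 : ContDiff ℝ 1 f := hf.of_le (by norm_num)
  have hz : ∀ x, x ∉ tsupport f → f x = 0 := fun x => image_eq_zero_of_notMem_tsupport
  have hcf := hf1.continuous
  have hch := hh.continuous
  have key : ∀ i j : Fin 3, ∫ x, conj (pderiv i f x) * (h x * pderiv j f x) =
      -∫ x, conj (f x) * (g x * x i * pderiv j f x + h x * pderiv i (pderiv j f) x) := by
    intro i j
    have hhC : ContDiff ℝ 1 fun x => (h x : ℂ) := ofRealCLM.contDiff.comp hh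
    rw [integral_conj_pderiv_mul hf1 hfs (hhC.mul (contDiff_pderiv hf j)) i]
    simp only [pderiv_ofReal_mul hh (contDiff_pderiv hf j), hhg, ofReal_mul]
  have hint1 : ∀ i j : Fin 3, Integrable fun x => conj (pderiv i f x) * (h x * pderiv j f x) := by
    intro i j
    have := continuous_pderiv hf1 i
    have := continuous_pderiv hf1 j
    exact Continuous.integrable_of_hasCompactSupport (by fun_prop)
      (HasCompactSupport.intro hfs.isCompact fun x hx => by simp [pderiv_eq_zero hx])
  have hint2 : ∀ i j : Fin 3, Integrable fun x =>
      conj (f x) * (g x * x i * pderiv j f x + h x * pderiv i (pderiv j f) x) := by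
    intro i j
    have := continuous_pderiv hf1 j
    have := continuous_pderiv (contDiff_pderiv hf j) i
    exact Continuous.integrable_of_hasCompactSupport (by fun_prop)
      (HasCompactSupport.intro hfs.isCompact fun x hx => by simp [hz x hx])
  have h1 := integral_sub (hint1 b a) (hint1 a b)
  have h2 := integral_sub (hint2 a b) (hint2 b a)
  rw [key, key, neg_sub_neg, ← h2] at h1
  have h3 := congrArg Complex.im h1
  have him : ∀ F : R3 → ℂ, Integrable F → (∫ x, F x).im = ∫ x, (F x).im :=
    fun F hF => (integral_im hF).symm
  replace h3 := (him _ ((hint1 b a).sub (hint1 a b))).symm.trans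
    (h3.trans (him _ ((hint2 a b).sub (hint2 b a))))
  simp only [Pi.sub_apply] at h3
  convert h3 using 2
  · ext x
    simp only [mul_im, mul_re, sub_im, conj_re, conj_im, ofReal_re, ofReal_im]
    ring
  · ext x
    rw [pderiv_comm hf a b x]
    simp only [angDeriv, mul_im, mul_re, sub_im, sub_re, add_im, add_re, conj_re, conj_im,
      ofReal_re, ofReal_im]
    ring

theorem integral_nullForm_add_angDeriv_nonneg {a b : Fin 3} (hab : a ≠ b) {f : R3 → ℂ}
    (hf : ContDiff ℝ 2 f) (hfs : HasCompactSupport f)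
    {h g : R3 → ℝ} (hh : ContDiff ℝ 1 h) (hg : Continuous g)
    (hhg : ∀ x i, fderiv ℝ h x (basisVec i) = g x * x i)
    (hg0 : ∀ x, 0 ≤ g x) (hgr : ∀ x y, ‖x‖ = ‖y‖ → g x = g y) :
    0 ≤ ∫ x, (h x * (2 * (pderiv a f x * conj (pderiv b f x)).im) +
      g x * normSq (angDeriv a b f x)) := by
  have hf1 : ContDiff ℝ 1 f := hf.of_le (by norm_num)
  have hcf := hf1.continuous
  have hch := hh.continuous
  have ha := continuous_pderiv hf1 a
  have hb := continuous_pderiv hf1 b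
  have hD := continuous_angDeriv hf1 a b
  have hDz : ∀ x, x ∉ tsupport f → angDeriv a b f x = 0 := fun x hx => by
    simp [angDeriv, pderiv_eq_zero hx]
  have h0 := integral_radial_mul_angDeriv_nonneg hab hf1 hfs hg hg0 hgr
  have hN : Continuous fun x => normSq (angDeriv a b f x) := continuous_normSq.comp hD
  have i1 : Integrable fun x => g x * normSq (angDeriv a b f x) :=
    (hg.mul hN).integrable_of_hasCompactSupport
      (HasCompactSupport.intro hfs.isCompact fun x hx => by simp [hDz x hx])
  have i2 : Integrable fun x => g x * (angDeriv a b f x * conj (f x)).im :=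
    (hg.mul (continuous_im.comp (hD.mul (continuous_conj.comp hcf)))).integrable_of_hasCompactSupport
      (HasCompactSupport.intro hfs.isCompact fun x hx => by simp [hDz x hx])
  have i3 : Integrable fun x => h x * (2 * (pderiv a f x * conj (pderiv b f x)).im) :=
    (hch.mul (continuous_const.mul (continuous_im.comp
      (ha.mul (continuous_conj.comp hb))))).integrable_of_hasCompactSupport
      (HasCompactSupport.intro hfs.isCompact fun x hx => by simp [pderiv_eq_zero hx])
  simp only [mul_add] at h0
  rw [integral_add i1 i2] at h0
  rw [integral_add i3 i1, integral_nullForm_eq hf hfs hh hg hhg]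
  linarith

/-- The regularized distance `√(|x|² + ε²)` to the origin. -/
def regNorm (ε : ℝ) (x : R3) : ℝ := Real.sqrt (‖x‖ ^ 2 + ε ^ 2)

theorem regNorm_pos {ε : ℝ} (hε : 0 < ε) (x : R3) : 0 < regNorm ε x :=
  Real.sqrt_pos.2 (by positivity)

theorem regNorm_sq (ε : ℝ) (x : R3) : regNorm ε x ^ 2 = ‖x‖ ^ 2 + ε ^ 2 :=
  Real.sq_sqrt (by positivity)

theorem contDiff_regNorm {ε : ℝ} (hε : 0 < ε) : ContDiff ℝ 1 (regNorm ε) :=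
  ((contDiff_norm_sq ℝ).add contDiff_const).sqrt fun x => by positivity

theorem fderiv_regNorm {ε : ℝ} (hε : 0 < ε) (x : R3) (i : Fin 3) :
    fderiv ℝ (regNorm ε) x (basisVec i) = x i / regNorm ε x := by
  have h : HasFDerivAt (regNorm ε) _ x :=
    ((hasStrictFDerivAt_norm_sq x).hasFDerivAt.add_const (ε ^ 2)).sqrt (by positivity)
  rw [h.fderiv]
  simp only [basisVec, smul_apply, innerSL_apply_apply,
    EuclideanSpace.inner_single_right, smul_eq_mul, nsmul_eq_mul, regNorm]
  simp
  field_simp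

theorem regNorm_congr (ε : ℝ) {x y : R3} (h : ‖x‖ = ‖y‖) : regNorm ε x = regNorm ε y := by
  simp only [regNorm, h]

theorem hasFDerivAt_regNorm {ε : ℝ} (hε : 0 < ε) (x : R3) :
    HasFDerivAt (regNorm ε) (fderiv ℝ (regNorm ε) x) x :=
  ((contDiff_regNorm hε).differentiable one_ne_zero x).hasFDerivAt

theorem contDiff_regWeight {ε : ℝ} (hε : 0 < ε) {α ν : ℝ} (hα : 0 < α) (hν : 0 < ν) :
    ContDiff ℝ 1 fun x => regNorm ε x / (α * regNorm ε x + ν) :=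
  (contDiff_regNorm hε).div ((contDiff_const.mul (contDiff_regNorm hε)).add contDiff_const)
    fun x => by have := regNorm_pos hε x; positivity

theorem fderiv_regWeight {ε : ℝ} (hε : 0 < ε) {α ν : ℝ} (hα : 0 < α) (hν : 0 < ν)
    (x : R3) (i : Fin 3) :
    fderiv ℝ (fun x => regNorm ε x / (α * regNorm ε x + ν)) x (basisVec i) =
      ν / ((α * regNorm ε x + ν) ^ 2 * regNorm ε x) * x i := by
  have hρ := regNorm_pos hε x
  have hd : HasDerivAt (fun s => s / (α * s + ν)) (ν / (α * regNorm ε x + ν) ^ 2)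
      (regNorm ε x) := by
    have h := (hasDerivAt_id (regNorm ε x)).div
      (((hasDerivAt_id (regNorm ε x)).const_mul α).add_const ν)
      (by simp only [id]; positivity)
    refine h.congr_deriv ?_
    simp only [id]
    ring
  have h := hd.comp_hasFDerivAt x (hasFDerivAt_regNorm hε x)
  have h' : fderiv ℝ (fun x => regNorm ε x / (α * regNorm ε x + ν)) x = _ := h.fderiv
  rw [h', smul_apply, fderiv_regNorm hε, smul_eq_mul]
  field_simp

theorem contDiff_coord_div_regNorm {ε : ℝ} (hε : 0 < ε) (i : Fin 3) :
    ContDiff ℝ 1 fun x : R3 => x i / regNorm ε x :=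
  (contDiff_piLp_apply 2).div (contDiff_regNorm hε) fun x => (regNorm_pos hε x).ne'

theorem fderiv_coord_div_regNorm {ε : ℝ} (hε : 0 < ε) (x : R3) (i : Fin 3) :
    fderiv ℝ (fun x : R3 => x i / regNorm ε x) x (basisVec i) =
      1 / regNorm ε x - x i ^ 2 / regNorm ε x ^ 3 := by
  have hρ := regNorm_pos hε x
  have h1 : HasFDerivAt (fun x : R3 => x i) (EuclideanSpace.proj i : R3 →L[ℝ] ℝ) x :=
    (EuclideanSpace.proj i : R3 →L[ℝ] ℝ).hasFDerivAt
  have h := h1.mul ((hasDerivAt_inv hρ.ne').comp_hasFDerivAt x (hasFDerivAt_regNorm hε x))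
  have hfun : (fun x : R3 => x i / regNorm ε x) = (fun x => x i) * (fun y => y⁻¹) ∘ regNorm ε := by
    ext y
    simp [div_eq_mul_inv]
  rw [hfun, h.fderiv]
  simp only [add_apply, smul_apply, fderiv_regNorm hε,
    smul_eq_mul, Function.comp]
  simp [basisVec]
  field_simp
  ring

theorem fderiv_normSq {f : R3 → ℂ} (hf : ContDiff ℝ 1 f) (i : Fin 3) (x : R3) :
    fderiv ℝ (fun y => normSq (f y)) x (basisVec i) = 2 * (conj (f x) * pderiv i f x).re := by
  have h := (hf.differentiable one_ne_zero x).hasFDerivAt.norm_sq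
  simp only [normSq_eq_norm_sq]
  rw [h.fderiv]
  simp [pderiv, Complex.inner]
  ring

/-- The Euler (dilation) derivative `x · ∇f`. -/
def eulerDeriv (f : R3 → ℂ) (x : R3) : ℂ := ∑ i, x i * pderiv i f x

theorem continuous_eulerDeriv {f : R3 → ℂ} (hf : ContDiff ℝ 1 f) : Continuous (eulerDeriv f) := by
  unfold eulerDeriv
  refine continuous_finsetSum _ fun i _ => ?_
  have := continuous_pderiv hf i
  fun_prop

theorem integral_div_regNorm_eq_zero {ε : ℝ} (hε : 0 < ε) {f : R3 → ℂ} (hf : ContDiff ℝ 1 f)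
    (hfs : HasCompactSupport f) :
    ∫ x, (2 / regNorm ε x * (conj (f x) * eulerDeriv f x).re +
      (2 / regNorm ε x + ε ^ 2 / regNorm ε x ^ 3) * normSq (f x)) = 0 := by
  have hz : ∀ x, x ∉ tsupport f → f x = 0 := fun x => image_eq_zero_of_notMem_tsupport
  have hcf := hf.continuous
  have hN : Continuous fun x => normSq (f x) := continuous_normSq.comp hcf
  have hNd : ContDiff ℝ 1 fun x => normSq (f x) := by
    simp only [normSq_eq_norm_sq]; exact hf.norm_sq ℝ
  have hcρ := (contDiff_regNorm hε).continuous
  have hρ0 : ∀ x, regNorm ε x ≠ 0 := fun x => (regNorm_pos hε x).ne'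
  have i1 : ∀ i : Fin 3, Integrable fun x : R3 =>
      x i / regNorm ε x * (2 * (conj (f x) * pderiv i f x).re) := fun i =>
    (Continuous.mul (contDiff_coord_div_regNorm hε i).continuous (continuous_const.mul
      (continuous_re.comp ((continuous_conj.comp hcf).mul
        (continuous_pderiv hf i))))).integrable_of_hasCompactSupport
      (HasCompactSupport.intro hfs.isCompact fun x hx => by simp [hz x hx])
  have hc2 : ∀ i : Fin 3, Continuous fun x : R3 =>
      1 / regNorm ε x - x i ^ 2 / regNorm ε x ^ 3 := fun i =>
    (continuous_const.div hcρ hρ0).sub (((by fun_prop : Continuous fun x : R3 => x i).pow 2).div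
      (hcρ.pow 3) fun x => pow_ne_zero 3 (hρ0 x))
  have i2 : ∀ i : Fin 3, Integrable fun x : R3 =>
      (1 / regNorm ε x - x i ^ 2 / regNorm ε x ^ 3) * normSq (f x) := fun i =>
    ((hc2 i).mul hN).integrable_of_hasCompactSupport
      (HasCompactSupport.intro hfs.isCompact fun x hx => by simp [hz x hx])
  have key : ∀ i : Fin 3, ∫ x : R3, (x i / regNorm ε x * (2 * (conj (f x) * pderiv i f x).re) +
      (1 / regNorm ε x - x i ^ 2 / regNorm ε x ^ 3) * normSq (f x)) = 0 := by
    intro i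
    rw [integral_add (i1 i) (i2 i), add_eq_zero_iff_eq_neg]
    have h := integral_mul_fderiv_eq_neg_fderiv_mul_of_integrable (𝕜 := ℝ)
      (μ := (volume : Measure R3)) (f := fun x : R3 => x i / regNorm ε x)
      (g := fun x => normSq (f x)) (v := basisVec i)
      (by simpa only [fderiv_coord_div_regNorm hε] using i2 i)
      (by simpa only [fderiv_normSq hf] using i1 i)
      (((contDiff_coord_div_regNorm hε i).continuous.mul hN).integrable_of_hasCompactSupport
        (HasCompactSupport.intro hfs.isCompact fun x hx => by simp [hz x hx]))
      (fun x _ => (contDiff_coord_div_regNorm hε i).differentiable one_ne_zero x)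
      (fun x _ => hNd.differentiable one_ne_zero x)
    simpa only [fderiv_coord_div_regNorm hε, fderiv_normSq hf] using h
  have hsum := integral_finsetSum Finset.univ fun i _ => (i1 i).add (i2 i)
  simp only [Pi.add_apply, key, Finset.sum_const_zero] at hsum
  rw [← hsum]
  congr 1
  ext x
  have hn : ‖x‖ ^ 2 = x 0 ^ 2 + x 1 ^ 2 + x 2 ^ 2 := by
    simp [EuclideanSpace.norm_sq_eq, Fin.sum_univ_three]
  have hs := regNorm_sq ε x
  rw [hn] at hs
  have hε2 : ε ^ 2 = regNorm ε x ^ 2 - (x 0 ^ 2 + x 1 ^ 2 + x 2 ^ 2) := by linarith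
  have hr := hρ0 x
  rw [hε2]
  simp only [eulerDeriv, Fin.sum_univ_three, mul_re, mul_im, add_re, add_im, ofReal_re, ofReal_im]
  field_simp
  ring

theorem integrable_radial_hardy {ε ν γ : ℝ} (hε : 0 < ε) (hν : 0 < ν) (hγ : 0 ≤ γ)
    {f : R3 → ℂ} (hf : ContDiff ℝ 1 f) (hfs : HasCompactSupport f) :
    Integrable fun x => regNorm ε x / ((1 + γ) * regNorm ε x + ν) *
      (normSq (eulerDeriv f x) / regNorm ε x ^ 2) +
        (1 - γ - ν / regNorm ε x) * normSq (f x) := by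
  have hz : ∀ x, x ∉ tsupport f → f x = 0 := fun x => image_eq_zero_of_notMem_tsupport
  have hzE : ∀ x, x ∉ tsupport f → eulerDeriv f x = 0 := fun x hx => by
    simp [eulerDeriv, pderiv_eq_zero hx]
  have hcρ := (contDiff_regNorm hε).continuous
  have hρ0 : ∀ x, regNorm ε x ≠ 0 := fun x => (regNorm_pos hε x).ne'
  have hch := (contDiff_regWeight hε (by linarith : 0 < 1 + γ) hν).continuous
  have hN : Continuous fun x => normSq (f x) := continuous_normSq.comp hf.continuous
  have hNE : Continuous fun x => normSq (eulerDeriv f x) :=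
    continuous_normSq.comp (continuous_eulerDeriv hf)
  exact ((hch.mul (hNE.div (hcρ.pow 2) fun x => pow_ne_zero 2 (hρ0 x))).add
    ((continuous_const.sub (continuous_const.div hcρ hρ0)).mul
      hN)).integrable_of_hasCompactSupport
    (HasCompactSupport.intro hfs.isCompact fun x hx => by simp [hz x hx, hzE x hx])

theorem integral_radial_hardy_nonneg {ε ν γ : ℝ} (hε : 0 < ε) (hν : 0 < ν) (hγ : 0 ≤ γ)
    (hγν : γ ^ 2 = 1 - ν ^ 2) {f : R3 → ℂ} (hf : ContDiff ℝ 1 f) (hfs : HasCompactSupport f) :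
    0 ≤ ∫ x, (regNorm ε x / ((1 + γ) * regNorm ε x + ν) *
      (normSq (eulerDeriv f x) / regNorm ε x ^ 2) + (1 - γ - ν / regNorm ε x) * normSq (f x)) := by
  have hz : ∀ x, x ∉ tsupport f → f x = 0 := fun x => image_eq_zero_of_notMem_tsupport
  have hcf := hf.continuous
  have hcρ := (contDiff_regNorm hε).continuous
  have hρ0 : ∀ x, regNorm ε x ≠ 0 := fun x => (regNorm_pos hε x).ne'
  have hα : 0 < 1 + γ := by linarith
  have hE := continuous_eulerDeriv hf
  have hN : Continuous fun x => normSq (f x) := continuous_normSq.comp hcf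
  have hi1 := integrable_radial_hardy hε hν hγ hf hfs
  have hi2 : Integrable fun x => 2 / regNorm ε x * (conj (f x) * eulerDeriv f x).re +
      (2 / regNorm ε x + ε ^ 2 / regNorm ε x ^ 3) * normSq (f x) :=
    (((continuous_const.div hcρ hρ0).mul (continuous_re.comp
      ((continuous_conj.comp hcf).mul hE))).add (((continuous_const.div hcρ hρ0).add
      (continuous_const.div (hcρ.pow 3) fun x => pow_ne_zero 3 (hρ0 x))).mul
        hN)).integrable_of_hasCompactSupport
      (HasCompactSupport.intro hfs.isCompact fun x hx => by simp [hz x hx])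
  have hzero := integral_div_regNorm_eq_zero hε hf hfs
  have hadd := integral_add hi1 (hi2.const_mul (ν / (1 + γ)))
  rw [integral_const_mul, hzero, mul_zero, add_zero] at hadd
  rw [← hadd]
  have hk : 0 < ν / (1 + γ) := by positivity
  refine integral_nonneg fun x => ?_
  have hρ := regNorm_pos hε x
  set ρ := regNorm ε x
  set F := f x
  set E := eulerDeriv f x
  have hw : 0 < (1 + γ) * ρ + ν := by positivity
  have hF : (ν / (1 + γ)) ^ 2 * (((1 + γ) * ρ + ν) / ρ) =
      1 - γ - ν / ρ + ν / (1 + γ) * (2 / ρ) := by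
    field_simp
    linear_combination ((1 + γ) * ρ + ν) * hγν
  generalize (1 + γ) * ρ + ν = w at hw hF ⊢
  generalize ν / (1 + γ) = k at *
  have hexp : ρ / w * normSq (E / ρ + (k * (w / ρ) : ℝ) * F) = ρ / w * (normSq E / ρ ^ 2) +
      k * (2 / ρ * (conj F * E).re) + k ^ 2 * (w / ρ) * normSq F := by
    simp only [normSq_apply, add_re, add_im, mul_re, mul_im, conj_re, conj_im, ofReal_re,
      ofReal_im, div_ofReal_re, div_ofReal_im]
    field_simp
    ring
  have hsq : 0 ≤ ρ / w * normSq (E / ρ + (k * (w / ρ) : ℝ) * F) :=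
    mul_nonneg (by positivity) (normSq_nonneg _)
  have hε3 : 0 ≤ k * (ε ^ 2 / ρ ^ 3) * normSq F :=
    mul_nonneg (by positivity) (normSq_nonneg _)
  refine (add_nonneg hsq hε3).trans (le_of_eq ?_)
  rw [hexp]
  linear_combination normSq F * hF

theorem pderiv_add_const_mul {f g : R3 → ℂ} (hf : ContDiff ℝ 1 f) (hg : ContDiff ℝ 1 g) (c : ℂ)
    (i : Fin 3) (x : R3) :
    pderiv i (fun y => f y + c * g y) x = pderiv i f x + c * pderiv i g x := by
  have h := (hf.differentiable one_ne_zero x).hasFDerivAt.add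
    ((hg.differentiable one_ne_zero x).hasFDerivAt.const_smul c)
  have h' : fderiv ℝ (fun y => f y + c * g y) x = _ := h.fderiv
  rw [pderiv, h']
  simp [pderiv]

theorem pd_apply {φ : R3 → C2} (hφ : ContDiff ℝ 1 φ) (k : Fin 3) (j : Fin 2) (x : R3) :
    pd φ k x j = pderiv k (fun y => φ y j) x := by
  have h := ((EuclideanSpace.proj j : C2 →L[ℂ] ℂ).restrictScalars ℝ).hasFDerivAt.comp x
    (hφ.differentiable one_ne_zero x).hasFDerivAt
  have h' : fderiv ℝ (fun y => φ y j) x = _ := h.fderiv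
  rw [pderiv, h']
  rfl

theorem norm_sigmaGrad_sq_s5 (φ : R3 → C2) (x : R3) :
    ‖sigmaGrad φ x‖ ^ 2 = normSq (pd φ 0 x 1 - I * pd φ 1 x 1 + pd φ 2 x 0) +
      normSq (pd φ 0 x 0 + I * pd φ 1 x 0 - pd φ 2 x 1) := by
  simp [EuclideanSpace.norm_sq_eq, Fin.sum_univ_two, sigmaGrad, normSq_eq_norm_sq]

theorem lagrange_identity (f : R3 → ℂ) (x : R3) :
    normSq (eulerDeriv f x) + normSq (angDeriv 0 1 f x) + normSq (angDeriv 1 2 f x) +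
        normSq (angDeriv 2 0 f x) =
      ‖x‖ ^ 2 * (normSq (pderiv 0 f x) + normSq (pderiv 1 f x) + normSq (pderiv 2 f x)) := by
  have hn : ‖x‖ ^ 2 = x 0 ^ 2 + x 1 ^ 2 + x 2 ^ 2 := by
    simp [EuclideanSpace.norm_sq_eq, Fin.sum_univ_three]
  rw [hn]
  simp only [eulerDeriv, angDeriv, Fin.sum_univ_three, normSq_apply, add_re, add_im, sub_re, sub_im,
    mul_re, mul_im, ofReal_re, ofReal_im]
  ring

theorem integrable_nullForm_add_angDeriv (a b : Fin 3) {f : R3 → ℂ}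
    (hf : ContDiff ℝ 1 f) (hfs : HasCompactSupport f)
    {h g : R3 → ℝ} (hh : Continuous h) (hg : Continuous g) :
    Integrable fun x => h x * (2 * (pderiv a f x * conj (pderiv b f x)).im) +
      g x * normSq (angDeriv a b f x) := by
  have ha := continuous_pderiv hf a
  have hb := continuous_pderiv hf b
  have hN : Continuous fun x => normSq (angDeriv a b f x) :=
    continuous_normSq.comp (continuous_angDeriv hf a b)
  exact ((hh.mul (continuous_const.mul (continuous_im.comp
    (ha.mul (continuous_conj.comp hb))))).add (hg.mul hN)).integrable_of_hasCompactSupport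
      (HasCompactSupport.intro hfs.isCompact fun x hx => by
        simp [angDeriv, pderiv_eq_zero hx])

theorem angDeriv_swap (a b : Fin 3) (f : R3 → ℂ) (x : R3) :
    angDeriv b a f x = -angDeriv a b f x := by
  simp only [angDeriv]; ring

theorem angDeriv_add_const_mul {f g : R3 → ℂ} (hf : ContDiff ℝ 1 f) (hg : ContDiff ℝ 1 g) (c : ℂ)
    (a b : Fin 3) (x : R3) :
    angDeriv a b (fun y => f y + c * g y) x = angDeriv a b f x + c * angDeriv a b g x := by
  simp only [angDeriv, pderiv_add_const_mul hf hg]; ring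

theorem normSq_sigma_expand (p₀ p₁ p₂ q₀ q₁ q₂ : ℂ) :
    normSq (q₀ - I * q₁ + p₂) + normSq (p₀ + I * p₁ - q₂) =
      normSq p₀ + normSq p₁ + normSq p₂ + normSq q₀ + normSq q₁ + normSq q₂ +
      2 * (p₀ * conj p₁).im + 2 * (q₁ * conj q₀).im +
      ((p₁ + 1 * q₁) * conj (p₂ + 1 * q₂)).im + ((p₂ + -1 * q₂) * conj (p₁ + -1 * q₁)).im +
      ((p₂ + -I * q₂) * conj (p₀ + -I * q₀)).im + ((p₀ + I * q₀) * conj (p₂ + I * q₂)).im := by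
  simp only [normSq_apply, add_re, add_im, sub_re, sub_im, mul_re, mul_im, conj_re, conj_im,
    I_re, I_im, neg_re, neg_im, one_re, one_im]
  ring

theorem normSq_add_unit_mul (c u v : ℂ) (hc : normSq c = 1) :
    normSq (u + c * v) + normSq (u + -c * v) = 2 * (normSq u + normSq v) := by
  simp only [normSq_apply, add_re, add_im, mul_re, mul_im, neg_re, neg_im] at *
  linear_combination (2 * v.re * v.re + 2 * v.im * v.im) * hc

theorem normSq_gradient_ge {ε ν α : ℝ} (hε : 0 < ε) (hν : 0 < ν) (hα : 0 < α)
    (f : R3 → ℂ) (x : R3) :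
    regNorm ε x / (α * regNorm ε x + ν) * (normSq (eulerDeriv f x) / regNorm ε x ^ 2) +
      ν / ((α * regNorm ε x + ν) ^ 2 * regNorm ε x) * (normSq (angDeriv 0 1 f x) +
        normSq (angDeriv 1 2 f x) + normSq (angDeriv 2 0 f x)) ≤
    regNorm ε x / (α * regNorm ε x + ν) *
      (normSq (pderiv 0 f x) + normSq (pderiv 1 f x) + normSq (pderiv 2 f x)) := by
  have hL := lagrange_identity f x
  have hρ := regNorm_pos hε x
  have hsq := regNorm_sq ε x
  set ρ := regNorm ε x
  have hD : 0 ≤ normSq (angDeriv 0 1 f x) + normSq (angDeriv 1 2 f x) +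
      normSq (angDeriv 2 0 f x) :=
    add_nonneg (add_nonneg (normSq_nonneg _) (normSq_nonneg _)) (normSq_nonneg _)
  have hG : 0 ≤ normSq (pderiv 0 f x) + normSq (pderiv 1 f x) + normSq (pderiv 2 f x) :=
    add_nonneg (add_nonneg (normSq_nonneg _) (normSq_nonneg _)) (normSq_nonneg _)
  generalize normSq (angDeriv 0 1 f x) = d₁ at *
  generalize normSq (angDeriv 1 2 f x) = d₂ at *
  generalize normSq (angDeriv 2 0 f x) = d₃ at *
  generalize normSq (pderiv 0 f x) + normSq (pderiv 1 f x) + normSq (pderiv 2 f x) = G at *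
  generalize normSq (eulerDeriv f x) = E at *
  have hw : 0 < α * ρ + ν := by positivity
  have hg : ν / ((α * ρ + ν) ^ 2 * ρ) ≤ ρ / (α * ρ + ν) / ρ ^ 2 := by
    have h1 : ρ / (α * ρ + ν) / ρ ^ 2 = (α * ρ + ν) / ((α * ρ + ν) ^ 2 * ρ) := by field_simp
    rw [h1]
    gcongr
    nlinarith
  have hsum : E + (d₁ + d₂ + d₃) ≤ ρ ^ 2 * G := by nlinarith [sq_nonneg ε]
  calc ρ / (α * ρ + ν) * (E / ρ ^ 2) + ν / ((α * ρ + ν) ^ 2 * ρ) * (d₁ + d₂ + d₃)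
      ≤ ρ / (α * ρ + ν) * (E / ρ ^ 2) + ρ / (α * ρ + ν) / ρ ^ 2 * (d₁ + d₂ + d₃) := by gcongr
    _ = ρ / (α * ρ + ν) / ρ ^ 2 * (E + (d₁ + d₂ + d₃)) := by ring
    _ ≤ ρ / (α * ρ + ν) / ρ ^ 2 * (ρ ^ 2 * G) := by gcongr
    _ = ρ / (α * ρ + ν) * G := by field_simp

theorem continuous_pd {φ : R3 → C2} (hφ : ContDiff ℝ 1 φ) (k : Fin 3) : Continuous (pd φ k) :=
  (hφ.continuous_fderiv one_ne_zero).clm_apply continuous_const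

theorem pd_eq_zero {φ : R3 → C2} {x : R3} (hx : x ∉ tsupport φ) (k : Fin 3) : pd φ k x = 0 := by
  have : fderiv ℝ φ x = 0 := by
    by_contra h
    exact hx (support_fderiv_subset ℝ h)
  simp [pd, this]

theorem continuous_norm_sigmaGrad_sq {φ : R3 → C2} (hφ : ContDiff ℝ 1 φ) :
    Continuous fun x => ‖sigmaGrad φ x‖ ^ 2 := by
  have h0 := continuous_pd hφ 0
  have h1 := continuous_pd hφ 1
  have h2 := continuous_pd hφ 2
  simp only [norm_sigmaGrad_sq_s5]
  refine (continuous_normSq.comp ?_).add (continuous_normSq.comp ?_) <;> fun_prop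

theorem sigmaGrad_eq_zero {φ : R3 → C2} {x : R3} (hx : x ∉ tsupport φ) :
    ‖sigmaGrad φ x‖ ^ 2 = 0 := by
  simp [norm_sigmaGrad_sq_s5, pd_eq_zero hx]

theorem integral_regularized_dirac_hardy_nonneg {ε ν γ : ℝ} (hε : 0 < ε) (hν : 0 < ν) (hγ : 0 ≤ γ)
    (hγν : γ ^ 2 = 1 - ν ^ 2) {φ : R3 → C2} (hφ : ContDiff ℝ 2 φ) (hφs : HasCompactSupport φ) :
    0 ≤ ∫ x, (regNorm ε x / ((1 + γ) * regNorm ε x + ν) * ‖sigmaGrad φ x‖ ^ 2 +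
      (1 - γ - ν / regNorm ε x) * ‖φ x‖ ^ 2) := by
  have hφ1 : ContDiff ℝ 1 φ := hφ.of_le (by norm_num)
  have hα : 0 < 1 + γ := by linarith
  set h : R3 → ℝ := fun x => regNorm ε x / ((1 + γ) * regNorm ε x + ν) with hdef
  set g : R3 → ℝ := fun x => ν / (((1 + γ) * regNorm ε x + ν) ^ 2 * regNorm ε x) with gdef
  have hcρ := (contDiff_regNorm hε).continuous
  have hρ0 : ∀ x, 0 < regNorm ε x := fun x => regNorm_pos hε x
  have hh : ContDiff ℝ 1 h := contDiff_regWeight hε hα hν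
  have hg : Continuous g := continuous_const.div (by fun_prop) fun x => by
    have := hρ0 x; positivity
  have hhg : ∀ x i, fderiv ℝ h x (basisVec i) = g x * x i := fderiv_regWeight hε hα hν
  have hg0 : ∀ x, 0 ≤ g x := fun x => by have := hρ0 x; simp only [gdef]; positivity
  have hgr : ∀ x y, ‖x‖ = ‖y‖ → g x = g y := fun x y hxy => by
    simp only [gdef, regNorm_congr ε hxy]
  have hj : ∀ j : Fin 2, ContDiff ℝ 2 fun y => φ y j := fun j =>
    ((EuclideanSpace.proj j : C2 →L[ℂ] ℂ).restrictScalars ℝ).contDiff.comp hφ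
  have hjs : ∀ j : Fin 2, HasCompactSupport fun y => φ y j := fun j =>
    hφs.comp_left (g := fun v : C2 => v j) rfl
  have hj1 : ∀ j : Fin 2, ContDiff ℝ 1 fun y => φ y j := fun j => (hj j).of_le (by norm_num)
  have huc : ∀ c : ℂ, ContDiff ℝ 2 fun y => φ y 0 + c * φ y 1 := fun c =>
    (hj 0).add (contDiff_const.mul (hj 1))
  have hucs : ∀ c : ℂ, HasCompactSupport fun y => φ y 0 + c * φ y 1 := fun c =>
    hφs.comp_left (g := fun v : C2 => v 0 + c * v 1) (by simp)
  have hS : ∀ (a b : Fin 3), a ≠ b → ∀ f : R3 → ℂ, ContDiff ℝ 2 f → HasCompactSupport f →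
      (Integrable fun x => h x * (2 * (pderiv a f x * conj (pderiv b f x)).im) +
        g x * normSq (angDeriv a b f x)) ∧
      0 ≤ ∫ x, (h x * (2 * (pderiv a f x * conj (pderiv b f x)).im) +
        g x * normSq (angDeriv a b f x)) := fun a b hab f hf hfs =>
    ⟨integrable_nullForm_add_angDeriv a b (hf.of_le (by norm_num)) hfs hh.continuous hg,
      integral_nullForm_add_angDeriv_nonneg hab hf hfs hh hg hhg hg0 hgr⟩
  have hadd : ∀ F G : R3 → ℝ, (Integrable F ∧ 0 ≤ ∫ x, F x) → (Integrable G ∧ 0 ≤ ∫ x, G x) →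
      (Integrable (fun x => F x + G x) ∧ 0 ≤ ∫ x, (F x + G x)) := fun F G hF hG =>
    ⟨hF.1.add hG.1, by rw [integral_add hF.1 hG.1]; exact add_nonneg hF.2 hG.2⟩
  have hhalf : ∀ F : R3 → ℝ, (Integrable F ∧ 0 ≤ ∫ x, F x) →
      (Integrable (fun x => 1 / 2 * F x) ∧ 0 ≤ ∫ x, 1 / 2 * F x) := fun F hF =>
    ⟨hF.1.const_mul _, by rw [integral_const_mul]; exact mul_nonneg (by norm_num) hF.2⟩
  have hR : ∀ j : Fin 2, _ := fun j => And.intro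
    (integrable_radial_hardy hε hν hγ (hj1 j) (hjs j))
    (integral_radial_hardy_nonneg hε hν hγ hγν (hj1 j) (hjs j))
  have hT := hadd _ _ (hadd _ _ (hadd _ _ (hS 0 1 (by decide) _ (hj 0) (hjs 0))
    (hS 1 0 (by decide) _ (hj 1) (hjs 1)))
    (hhalf _ (hadd _ _ (hadd _ _ (hS 1 2 (by decide) _ (huc 1) (hucs 1))
      (hS 2 1 (by decide) _ (huc (-1)) (hucs (-1))))
      (hadd _ _ (hS 2 0 (by decide) _ (huc (-I)) (hucs (-I)))
        (hS 0 2 (by decide) _ (huc I) (hucs I)))))) (hadd _ _ (hR 0) (hR 1))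
  refine hT.2.trans (integral_mono hT.1 ?_ fun x => ?_)
  · have hzφ : ∀ x, x ∉ tsupport φ → φ x = 0 := fun x => image_eq_zero_of_notMem_tsupport
    have hcs := continuous_norm_sigmaGrad_sq hφ1
    exact ((hh.continuous.mul hcs).add ((continuous_const.sub (continuous_const.div hcρ
      fun x => (hρ0 x).ne')).mul (hφ1.continuous.norm.pow 2))).integrable_of_hasCompactSupport
      (HasCompactSupport.intro hφs.isCompact fun x hx => by
        simp [hzφ x hx, sigmaGrad_eq_zero hx])
  · have h0 := normSq_gradient_ge hε hν hα (fun y => φ y 0) x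
    have h1 := normSq_gradient_ge hε hν hα (fun y => φ y 1) x
    have hn : ‖φ x‖ ^ 2 = normSq (φ x 0) + normSq (φ x 1) := by
      simp [EuclideanSpace.norm_sq_eq, Fin.sum_univ_two, normSq_eq_norm_sq]
    have hexp := normSq_sigma_expand (pderiv 0 (fun y => φ y 0) x) (pderiv 1 (fun y => φ y 0) x)
      (pderiv 2 (fun y => φ y 0) x) (pderiv 0 (fun y => φ y 1) x) (pderiv 1 (fun y => φ y 1) x)
      (pderiv 2 (fun y => φ y 1) x)
    have e1 := normSq_add_unit_mul 1 (angDeriv 1 2 (fun y => φ y 0) x)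
      (angDeriv 1 2 (fun y => φ y 1) x) (by simp)
    have e2 := normSq_add_unit_mul I (angDeriv 2 0 (fun y => φ y 0) x)
      (angDeriv 2 0 (fun y => φ y 1) x) (by simp)
    simp only [angDeriv_add_const_mul (hj1 0) (hj1 1), pderiv_add_const_mul (hj1 0) (hj1 1),
      norm_sigmaGrad_sq_s5, pd_apply hφ1, hn, hexp, angDeriv_swap 1 2, angDeriv_swap 0 1,
      angDeriv_swap 2 0, normSq_neg, ← neg_add, mul_neg]
    change h x * _ + g x * _ ≤ h x * _ at h0 h1
    nlinarith [h0, h1, congrArg (g x * ·) e1, congrArg (g x * ·) e2]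

theorem integrable_inv_norm_mul {q : R3 → ℝ} (hq : Continuous q) (hqs : HasCompactSupport q) :
    Integrable fun x => ‖x‖⁻¹ * q x := by
  have hloc : LocallyIntegrable (fun x : R3 => ‖x‖⁻¹) volume :=
    locallyIntegrable_of_norm_le_rpow (C := 1) (α := 1) (by simp) (by simp)
      (Filter.Eventually.of_forall fun x => by simp [Real.rpow_neg_one])
      measurable_norm.inv.aestronglyMeasurable
  simpa using hloc.integrable_smul_right_of_hasCompactSupport hq hqs

theorem tendsto_regNorm (x : R3) :
    Filter.Tendsto (fun ε => regNorm ε x) (nhdsWithin 0 (Set.Ioi 0)) (nhds ‖x‖) := by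
  have hc : Continuous fun ε => regNorm ε x := by unfold regNorm; fun_prop
  have := hc.tendsto 0
  rw [regNorm, zero_pow two_ne_zero, add_zero, Real.sqrt_sq (norm_nonneg x)] at this
  exact this.mono_left nhdsWithin_le_nhds

theorem norm_le_regNorm (ε : ℝ) (x : R3) : ‖x‖ ≤ regNorm ε x :=
  Real.le_sqrt_of_sq_le (le_add_of_nonneg_right (sq_nonneg ε))

theorem ae_ne_zero : ∀ᵐ x : R3, x ≠ 0 := by
  simp [ae_iff, measure_singleton]

theorem integrable_dirac_hardy_bound {φ : R3 → C2} (hφ : ContDiff ℝ 1 φ)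
    (hφs : HasCompactSupport φ) :
    (Integrable fun x => ‖sigmaGrad φ x‖ ^ 2) ∧ (Integrable fun x => ‖φ x‖ ^ 2) ∧
      Integrable fun x => ‖x‖⁻¹ * ‖φ x‖ ^ 2 := by
  have hz : ∀ x, x ∉ tsupport φ → φ x = 0 := fun x => image_eq_zero_of_notMem_tsupport
  have hq : Continuous fun x => ‖φ x‖ ^ 2 := hφ.continuous.norm.pow 2
  have hqs : HasCompactSupport fun x => ‖φ x‖ ^ 2 :=
    HasCompactSupport.intro hφs.isCompact fun x hx => by simp [hz x hx]
  exact ⟨(continuous_norm_sigmaGrad_sq hφ).integrable_of_hasCompactSupport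
    (HasCompactSupport.intro hφs.isCompact fun x hx => sigmaGrad_eq_zero hx),
    hq.integrable_of_hasCompactSupport hqs, integrable_inv_norm_mul hq hqs⟩

/-- The Hardy-type inequality for the Dirac–Coulomb operator. -/
theorem integral_dirac_hardy_nonneg {ν γ : ℝ} (hν : 0 < ν) (hγ : 0 ≤ γ)
    (hγν : γ ^ 2 = 1 - ν ^ 2) {φ : R3 → C2} (hφ : ContDiff ℝ 2 φ) (hφs : HasCompactSupport φ) :
    0 ≤ ∫ x, (‖sigmaGrad φ x‖ ^ 2 / (1 + γ + ν / ‖x‖) + (1 - γ - ν / ‖x‖) * ‖φ x‖ ^ 2) := by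
  have hφ1 : ContDiff ℝ 1 φ := hφ.of_le (by norm_num)
  have hα : 0 < 1 + γ := by linarith
  obtain ⟨ip, iq, iqr⟩ := integrable_dirac_hardy_bound hφ1 hφs
  have hcp := continuous_norm_sigmaGrad_sq hφ1
  have hcq : Continuous fun x => ‖φ x‖ ^ 2 := hφ1.continuous.norm.pow 2
  have hmem : ∀ᶠ ε : ℝ in nhdsWithin 0 (Set.Ioi 0), 0 < ε := self_mem_nhdsWithin
  refine ge_of_tendsto (x := nhdsWithin (0 : ℝ) (Set.Ioi 0))
    (f := fun ε => ∫ x, (regNorm ε x / ((1 + γ) * regNorm ε x + ν) * ‖sigmaGrad φ x‖ ^ 2 +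
      (1 - γ - ν / regNorm ε x) * ‖φ x‖ ^ 2)) ?_
    (hmem.mono fun ε hε => integral_regularized_dirac_hardy_nonneg hε hν hγ hγν hφ hφs)
  refine tendsto_integral_filter_of_dominated_convergence
    (fun x => ‖sigmaGrad φ x‖ ^ 2 / (1 + γ) + (|1 - γ| * ‖φ x‖ ^ 2 + ν * (‖x‖⁻¹ * ‖φ x‖ ^ 2)))
    (hmem.mono fun ε hε => ?_) (hmem.mono fun ε hε => ?_)
    ((ip.div_const _).add ((iq.const_mul _).add (iqr.const_mul _))) ?_
  · exact (((contDiff_regWeight hε hα hν).continuous.mul hcp).add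
      ((continuous_const.sub (continuous_const.div (contDiff_regNorm hε).continuous
        fun x => (regNorm_pos hε x).ne')).mul hcq)).aestronglyMeasurable
  · filter_upwards [ae_ne_zero] with x hx
    have hx' : 0 < ‖x‖ := norm_pos_iff.2 hx
    have hρ := regNorm_pos hε x
    have hle := norm_le_regNorm ε x
    have hw : 0 < (1 + γ) * regNorm ε x + ν := by positivity
    have h1 : |regNorm ε x / ((1 + γ) * regNorm ε x + ν)| ≤ 1 / (1 + γ) := by
      rw [abs_of_pos (by positivity), div_le_div_iff₀ hw hα]
      nlinarith
    have h2 : |1 - γ - ν / regNorm ε x| ≤ |1 - γ| + ν * ‖x‖⁻¹ := by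
      refine (abs_sub _ _).trans ?_
      rw [abs_of_pos (by positivity : 0 < ν / regNorm ε x), div_eq_mul_inv]
      gcongr
    rw [Real.norm_eq_abs]
    refine (abs_add_le _ _).trans ?_
    rw [abs_mul, abs_mul, abs_of_nonneg (sq_nonneg ‖φ x‖),
      abs_of_nonneg (sq_nonneg ‖sigmaGrad φ x‖)]
    calc _ ≤ 1 / (1 + γ) * ‖sigmaGrad φ x‖ ^ 2 + (|1 - γ| + ν * ‖x‖⁻¹) * ‖φ x‖ ^ 2 := by gcongr
      _ = _ := by ring
  · filter_upwards [ae_ne_zero] with x hx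
    have hx' : 0 < ‖x‖ := norm_pos_iff.2 hx
    have ht := tendsto_regNorm x
    have he : ‖sigmaGrad φ x‖ ^ 2 / (1 + γ + ν / ‖x‖) =
        ‖x‖ / ((1 + γ) * ‖x‖ + ν) * ‖sigmaGrad φ x‖ ^ 2 := by
      field_simp
    rw [he]
    exact ((ht.div ((ht.const_mul (1 + γ)).add_const ν) (by positivity)).mul_const _).add
      ((((tendsto_const_nhds (x := ν)).div ht hx'.ne').const_sub (1 - γ)).mul_const _)

theorem integrable_dirac_hardy {ν γ : ℝ} (hν : 0 < ν) (hγ : 0 ≤ γ) {φ : R3 → C2}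
    (hφ : ContDiff ℝ 1 φ) (hφs : HasCompactSupport φ) :
    Integrable fun x => ‖sigmaGrad φ x‖ ^ 2 / (1 + γ + ν / ‖x‖) +
      (1 - γ - ν / ‖x‖) * ‖φ x‖ ^ 2 := by
  obtain ⟨ip, iq, iqr⟩ := integrable_dirac_hardy_bound hφ hφs
  have hα : 0 < 1 + γ := by linarith
  refine Integrable.add ?_ ?_
  · refine (ip.div_const (1 + γ)).mono' ((continuous_norm_sigmaGrad_sq hφ).measurable.div
      (measurable_const.add (measurable_const.div measurable_norm))).aestronglyMeasurable
      (Filter.Eventually.of_forall fun x => ?_)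
    have hx : 0 ≤ ν / ‖x‖ := by positivity
    rw [Real.norm_of_nonneg (by positivity)]
    exact div_le_div_of_nonneg_left (sq_nonneg _) hα (by linarith)
  · refine ((iq.const_mul (1 - γ)).sub (iqr.const_mul ν)).congr
      (Filter.Eventually.of_forall fun x => ?_)
    simp only [Pi.sub_apply]
    ring

theorem integrable_potential_mul {V : R3 → ℝ} {ν c₁ c₂ : ℝ} (hν : 0 < ν) (hc₁ : 0 ≤ c₁)
    (hc₂ : 0 ≤ c₂) (hVmeas : Measurable V)
    (hV : ∀ᵐ x : R3, -ν / ‖x‖ - c₁ ≤ V x ∧ V x ≤ c₂) {φ : R3 → C2} (hφ : ContDiff ℝ 1 φ)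
    (hφs : HasCompactSupport φ) : Integrable fun x => (1 + V x) * ‖φ x‖ ^ 2 := by
  obtain ⟨-, iq, iqr⟩ := integrable_dirac_hardy_bound hφ hφs
  refine ((iq.const_mul (1 + c₁ + c₂)).add (iqr.const_mul ν)).mono'
    ((measurable_const.add hVmeas).mul
      (hφ.continuous.norm.pow 2).measurable).aestronglyMeasurable ?_
  filter_upwards [hV] with x hx
  have hr : 0 ≤ ν * ‖x‖⁻¹ := by positivity
  have h1 : |1 + V x| ≤ 1 + c₁ + c₂ + ν * ‖x‖⁻¹ := by
    rw [neg_div, div_eq_mul_inv] at hx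
    rw [abs_le]
    constructor <;> linarith
  rw [Real.norm_eq_abs, abs_mul, abs_of_nonneg (sq_nonneg ‖φ x‖)]
  calc _ ≤ (1 + c₁ + c₂ + ν * ‖x‖⁻¹) * ‖φ x‖ ^ 2 := by gcongr
    _ = _ := by simp only [Pi.add_apply]; ring

theorem sigmaGrad_div_bound {V : R3 → ℝ} {c₂ : ℝ} (hV : ∀ᵐ x : R3, V x ≤ c₂) (φ : R3 → C2)
    {a b : ℝ} (ha : c₂ - 1 < a) (hab : a ≤ b) :
    ∀ᵐ x : R3, ‖‖sigmaGrad φ x‖ ^ 2 / (1 - V x + b)‖ ≤ ‖sigmaGrad φ x‖ ^ 2 / (1 - c₂ + a) := by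
  filter_upwards [hV] with x hx
  have h0 : 0 < 1 - c₂ + a := by linarith
  have h1 : 1 - c₂ + a ≤ 1 - V x + b := by linarith
  rw [Real.norm_of_nonneg (div_nonneg (sq_nonneg _) (h0.le.trans h1))]
  gcongr

theorem aestronglyMeasurable_sigmaGrad_div {V : R3 → ℝ} (hVmeas : Measurable V) {φ : R3 → C2}
    (hφ : ContDiff ℝ 1 φ) (a : ℝ) :
    AEStronglyMeasurable (fun x => ‖sigmaGrad φ x‖ ^ 2 / (1 - V x + a)) volume :=
  ((continuous_norm_sigmaGrad_sq hφ).measurable.div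
    ((measurable_const.sub hVmeas).add_const a)).aestronglyMeasurable

theorem integrable_sigmaGrad_div {V : R3 → ℝ} {c₂ : ℝ} (hVmeas : Measurable V)
    (hV : ∀ᵐ x : R3, V x ≤ c₂) {φ : R3 → C2} (hφ : ContDiff ℝ 1 φ) (hφs : HasCompactSupport φ)
    {a : ℝ} (ha : c₂ - 1 < a) : Integrable fun x => ‖sigmaGrad φ x‖ ^ 2 / (1 - V x + a) :=
  ((integrable_dirac_hardy_bound hφ hφs).1.div_const (1 - c₂ + a)).mono'
    (aestronglyMeasurable_sigmaGrad_div hVmeas hφ a) (sigmaGrad_div_bound hV φ ha le_rfl)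

theorem integral_sigmaGrad_div_antitone {V : R3 → ℝ} {c₂ : ℝ} (hVmeas : Measurable V)
    (hV : ∀ᵐ x : R3, V x ≤ c₂) {φ : R3 → C2} (hφ : ContDiff ℝ 1 φ) (hφs : HasCompactSupport φ)
    {a b : ℝ} (ha : c₂ - 1 < a) (hab : a ≤ b) :
    ∫ x, ‖sigmaGrad φ x‖ ^ 2 / (1 - V x + b) ≤ ∫ x, ‖sigmaGrad φ x‖ ^ 2 / (1 - V x + a) := by
  refine integral_mono_ae (integrable_sigmaGrad_div hVmeas hV hφ hφs (ha.trans_le hab))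
    (integrable_sigmaGrad_div hVmeas hV hφ hφs ha) ?_
  filter_upwards [hV] with x hx
  have : 0 < 1 - V x + a := by linarith
  gcongr

theorem continuousOn_integral_sigmaGrad_div {V : R3 → ℝ} {c₂ : ℝ} (hVmeas : Measurable V)
    (hV : ∀ᵐ x : R3, V x ≤ c₂) {φ : R3 → C2} (hφ : ContDiff ℝ 1 φ) (hφs : HasCompactSupport φ)
    {a : ℝ} (ha : c₂ - 1 < a) :
    ContinuousOn (fun l => ∫ x, ‖sigmaGrad φ x‖ ^ 2 / (1 - V x + l)) (Set.Ici a) := by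
  refine continuousOn_of_dominated (fun l _ => aestronglyMeasurable_sigmaGrad_div hVmeas hφ l)
    (fun l hl => sigmaGrad_div_bound hV φ ha hl)
    ((integrable_dirac_hardy_bound hφ hφs).1.div_const _) ?_
  filter_upwards [hV] with x hx
  refine continuousOn_const.div (by fun_prop) fun l hl => ?_
  have : a ≤ l := hl
  linarith

theorem mul_integral_le_of_dirac_hardy {V : R3 → ℝ} {ν c₁ c₂ γ l : ℝ} (hν : 0 < ν) (hγ : 0 ≤ γ)
    (hγν : γ ^ 2 = 1 - ν ^ 2) (hc₁ : 0 ≤ c₁) (hc₂ : 0 ≤ c₂) (hVmeas : Measurable V)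
    (hV : ∀ᵐ x : R3, -ν / ‖x‖ - c₁ ≤ V x ∧ V x ≤ c₂) {φ : R3 → C2} (hφ : ContDiff ℝ 2 φ)
    (hφs : HasCompactSupport φ) (hl : c₂ - 1 < l) (hlγ : c₁ + l ≤ γ) :
    l * ∫ x, ‖φ x‖ ^ 2 ≤ (∫ x, ‖sigmaGrad φ x‖ ^ 2 / (1 - V x + l)) +
      ∫ x, (1 + V x) * ‖φ x‖ ^ 2 := by
  have hφ1 : ContDiff ℝ 1 φ := hφ.of_le (by norm_num)
  have iq := (integrable_dirac_hardy_bound hφ1 hφs).2.1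
  have iA := integrable_sigmaGrad_div hVmeas (hV.mono fun x hx => hx.2) hφ1 hφs hl
  have iB := integrable_potential_mul hν hc₁ hc₂ hVmeas hV hφ1 hφs
  have hG := (integral_dirac_hardy_nonneg hν hγ hγν hφ hφs).trans (integral_mono_ae
    (g := fun x => ‖sigmaGrad φ x‖ ^ 2 / (1 - V x + l) + (1 + V x) * ‖φ x‖ ^ 2 - l * ‖φ x‖ ^ 2)
    (integrable_dirac_hardy hν hγ hφ1 hφs) ((iA.add iB).sub (iq.const_mul l)) ?_)
  · have h1 := integral_add iA iB
    have h2 := integral_sub (iA.add iB) (iq.const_mul l)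
    simp only [Pi.add_apply] at h2
    rw [h2, h1, integral_const_mul] at hG
    linarith
  · filter_upwards [hV] with x ⟨hx1, hx2⟩
    rw [neg_div] at hx1
    have h0 : 0 < 1 - V x + l := by linarith
    have h1 : ‖sigmaGrad φ x‖ ^ 2 / (1 + γ + ν / ‖x‖) ≤ ‖sigmaGrad φ x‖ ^ 2 / (1 - V x + l) :=
      div_le_div_of_nonneg_left (sq_nonneg _) h0 (by linarith)
    have h2 : (1 - γ - ν / ‖x‖) * ‖φ x‖ ^ 2 ≤ (1 + V x - l) * ‖φ x‖ ^ 2 :=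
      mul_le_mul_of_nonneg_right (by linarith) (sq_nonneg _)
    linarith

theorem existsUnique_mul_eq_of_antitone {A : ℝ → ℝ} {B Q a b : ℝ} (hQ : 0 < Q) (hab : a < b)
    (hanti : ∀ s t, a < s → s ≤ t → A t ≤ A s) (hcont : ContinuousOn A (Set.Ici b))
    (hb : b * Q ≤ A b + B) : ∃! l : ℝ, a < l ∧ l * Q = A l + B := by
  have hle : ∀ s t, a < s → s * Q = A s + B → t * Q = A t + B → t ≤ s := fun s t hs h1 h2 => by
    by_contra! h
    have := hanti s t hs h.le
    nlinarith
  have hbc : b ≤ (A b + B) / Q := (le_div_iff₀ hQ).2 hb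
  have hc : A ((A b + B) / Q) + B ≤ (A b + B) / Q * Q := by
    rw [div_mul_cancel₀ _ hQ.ne']
    linarith [hanti _ _ hab hbc]
  obtain ⟨l, hl, hl0⟩ := intermediate_value_Icc' (f := fun l => A l + B - l * Q) hbc
    (((hcont.mono Set.Icc_subset_Ici_self).add continuousOn_const).sub (by fun_prop))
    ⟨sub_nonpos.2 hc, sub_nonneg.2 hb⟩
  have hal : a < l := hab.trans_le hl.1
  have hl' : l * Q = A l + B := by
    have : A l + B - l * Q = 0 := hl0
    linarith
  exact ⟨l, ⟨hal, hl'⟩, fun t ht => le_antisymm (hle l t hal hl' ht.2) (hle t l ht.1 ht.2 hl')⟩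

end

/-- Existence and uniqueness of the level `λ^T(V,φ)` solving the nonlinear
Euler-Lagrange equation. -/
theorem lambdaT_exists_unique (ν c₁ c₂ : ℝ) (hν : ν ∈ Set.Ioo (0 : ℝ) 1)
    (hc₁ : 0 ≤ c₁) (hc₂ : 0 ≤ c₂) (hgap : c₁ + c₂ - 1 < Real.sqrt (1 - ν ^ 2))
    (V : R3 → ℝ) (hVmeas : Measurable V)
    (hV₀ : Filter.Tendsto V (Filter.cocompact R3) (nhds 0))
    (hV : ∀ᵐ x ∂(volume : Measure R3), -ν / ‖x‖ - c₁ ≤ V x ∧ V x ≤ c₂)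
    (φ : R3 → C2) (hφ : IsCc φ) (hφ0 : φ ≠ 0) :
    ∃! lam : ℝ, c₂ - 1 < lam ∧
      lam * ∫ x : R3, ‖φ x‖ ^ 2 =
        ∫ x : R3, (‖sigmaGrad φ x‖ ^ 2 / (1 - V x + lam)
          + (1 + V x) * ‖φ x‖ ^ 2) := by
  obtain ⟨hφd, hφs⟩ := hφ
  have hφ2 : ContDiff ℝ 2 φ := hφd.of_le (WithTop.coe_le_coe.2 le_top)
  have hφ1 : ContDiff ℝ 1 φ := hφ2.of_le (by norm_num)
  have hVle : ∀ᵐ x : R3, V x ≤ c₂ := hV.mono fun x hx => hx.2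
  have hQ : 0 < ∫ x, ‖φ x‖ ^ 2 := by
    obtain ⟨x, hx⟩ := Function.ne_iff.1 hφ0
    refine (hφ1.continuous.norm.pow 2).integral_pos_of_hasCompactSupport_nonneg_nonzero
      (HasCompactSupport.intro hφs.isCompact fun y hy => ?_) (fun y => sq_nonneg _)
      (pow_ne_zero 2 (norm_ne_zero_iff.2 hx))
    simp [image_eq_zero_of_notMem_tsupport hy]
  have hγν : Real.sqrt (1 - ν ^ 2) ^ 2 = 1 - ν ^ 2 :=
    Real.sq_sqrt (by nlinarith [hν.1, hν.2])
  have hmain := existsUnique_mul_eq_of_antitone hQ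
    (by linarith : c₂ - 1 < (c₂ - 1 + (Real.sqrt (1 - ν ^ 2) - c₁)) / 2)
    (fun s t hs hst => integral_sigmaGrad_div_antitone hVmeas hVle hφ1 hφs hs hst)
    (continuousOn_integral_sigmaGrad_div hVmeas hVle hφ1 hφs (by linarith))
    (mul_integral_le_of_dirac_hardy hν.1 (Real.sqrt_nonneg _) hγν hc₁ hc₂ hVmeas hV hφ2 hφs
      (by linarith) (by linarith))
  refine (existsUnique_congr fun l => and_congr_right fun hl => ?_).1 hmain
  rw [integral_add (integrable_sigmaGrad_div hVmeas hVle hφ1 hφs hl)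
    (integrable_potential_mul hν.1 hc₁ hc₂ hVmeas hV hφ1 hφs)]
end
end
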